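/- arXiv:math/0604322 — 3 statements merged into one kernel-verified Lean document; each statement's English description precedes it below -/
import Mathlib

section
/- For every n ≥ 2 and every k ≥ 0, the number of permutations w ∈ S_n of length k that avoid both patterns 321 and 231 equals the binomial coefficient C(n−1, k), and the number of permutations w ∈ S_n of length k that avoid both patterns 321 and 312 also equals C(n−1, k). -/
namespace Paper

/-! ### Type A: the symmetric group `S_n` as `Equiv.Perm (Fin n)` -/

/-- The simple transposition `s_i ∈ S_n` (1-indexed letter `i`, meaningful for
`1 ≤ i ≤ n-1`): it interchanges the entries in (1-indexed) positions `i` and `i+1`,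
i.e. (0-indexed) positions `i-1` and `i` of `Fin n`. Out-of-range letters give `1`. -/
def sA (n : ℕ) (i : ℕ) : Equiv.Perm (Fin n) :=
  if h : 1 ≤ i ∧ i < n then Equiv.swap ⟨i - 1, by omega⟩ ⟨i, h.2⟩ else 1

/-- The product `s_{i_1} ⋯ s_{i_ℓ}` of a word `i_1 ⋯ i_ℓ`. -/
def prodA (n : ℕ) (w : List ℕ) : Equiv.Perm (Fin n) := (w.map (sA n)).prod

/-- A word in the letters `{1, …, n-1}`. -/
def IsWordA (n : ℕ) (w : List ℕ) : Prop := ∀ i ∈ w, 1 ≤ i ∧ i ≤ n - 1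

/-- `w` is a reduced decomposition of `x ∈ S_n`. -/
def ReducedA (n : ℕ) (w : List ℕ) (x : Equiv.Perm (Fin n)) : Prop :=
  IsWordA n w ∧ prodA n w = x ∧
    ∀ w' : List ℕ, IsWordA n w' → prodA n w' = x → w.length ≤ w'.length

/-- The Coxeter length `ℓ(x)`: minimal length of a word for `x`. -/
noncomputable def lenA (n : ℕ) (x : Equiv.Perm (Fin n)) : ℕ :=
  sInf {l | ∃ w : List ℕ, IsWordA n w ∧ prodA n w = x ∧ w.length = l}

/-- Bruhat order on `S_n`: `v ≤ w` iff some reduced decomposition of `v` is a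
(not necessarily consecutive) subword of some reduced decomposition of `w`. -/
def bruhatA (n : ℕ) (v w : Equiv.Perm (Fin n)) : Prop :=
  ∃ a b : List ℕ, ReducedA n a v ∧ ReducedA n b w ∧ a.Sublist b

/-- `w ∈ S_n` is boolean: the principal order ideal `B(w)`, ordered by the Bruhat
order, is order-isomorphic to the lattice of all subsets of `{1,…,r}` for some `r`. -/
def BooleanA (n : ℕ) (w : Equiv.Perm (Fin n)) : Prop :=
  ∃ (r : ℕ) (e : {v : Equiv.Perm (Fin n) // bruhatA n v w} ≃ Finset (Fin r)),
    ∀ a b : {v : Equiv.Perm (Fin n) // bruhatA n v w}, bruhatA n a.1 b.1 ↔ e a ⊆ e b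

/-- Pattern containment: `w ∈ S_n` contains `p ∈ S_k`. -/
def ContainsA {n k : ℕ} (w : Equiv.Perm (Fin n)) (p : Equiv.Perm (Fin k)) : Prop :=
  ∃ f : Fin k → Fin n, StrictMono f ∧ ∀ a b : Fin k, w (f a) < w (f b) ↔ p a < p b

/-- Pattern avoidance. -/
def AvoidsA {n k : ℕ} (w : Equiv.Perm (Fin n)) (p : Equiv.Perm (Fin k)) : Prop :=
  ¬ ContainsA w p

/-- The pattern `321` (one-line notation). -/
def p321 : Equiv.Perm (Fin 3) := ⟨![2,1,0], ![2,1,0], by decide, by decide⟩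
/-- The pattern `231` (one-line notation). -/
def p231 : Equiv.Perm (Fin 3) := ⟨![1,2,0], ![2,0,1], by decide, by decide⟩
/-- The pattern `312` (one-line notation). -/
def p312 : Equiv.Perm (Fin 3) := ⟨![2,0,1], ![1,2,0], by decide, by decide⟩
/-- The pattern `3412` (one-line notation). -/
def p3412 : Equiv.Perm (Fin 4) := ⟨![2,3,0,1], ![2,3,0,1], by decide, by decide⟩

/-- The longest (decreasing) permutation `w_0^{(k)} = k (k-1) ⋯ 2 1 ∈ S_k`. -/
def w0 (k : ℕ) : Equiv.Perm (Fin k) := Fin.revPerm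

/-- The shift of a word by `M`: each letter `i` becomes `i + M`. -/
def shift (M : ℕ) (w : List ℕ) : List ℕ := w.map (· + M)




/-! ### Types B and D: signed permutations, modelled as permutations `w` of `ℤ`
with `w(-x) = -w(x)` that fix all integers of absolute value `> n`. -/

/-- The simple generators of `S_n^B`, as permutations of `ℤ`:
`sB 0` negates the value `1`; for `i ≥ 1`, `sB i` interchanges the values
`i` and `i+1` (and `-i` and `-(i+1)`). -/
def sB : ℕ → Equiv.Perm ℤ
  | 0 => Equiv.swap 1 (-1)
  | (i+1) => Equiv.swap ((i : ℤ) + 1) ((i : ℤ) + 2) * Equiv.swap (-((i : ℤ) + 1)) (-((i : ℤ) + 2))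

/-- The simple generators of `S_n^D`: letter `0` encodes `s_{1'} = s_0 s_1 s_0`
(mapping `1 ↦ -2` and `2 ↦ -1`), and letters `i ≥ 1` are as in type `B`. -/
def sD : ℕ → Equiv.Perm ℤ
  | 0 => sB 0 * sB 1 * sB 0
  | (i+1) => sB (i+1)

def prodB (w : List ℕ) : Equiv.Perm ℤ := (w.map sB).prod
def prodD (w : List ℕ) : Equiv.Perm ℤ := (w.map sD).prod

/-- A word in the type `B`/`D` letters `{0, 1, …, n-1}`. -/
def IsWordBD (n : ℕ) (w : List ℕ) : Prop := ∀ i ∈ w, i ≤ n - 1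

/-- `w` is a reduced decomposition of `x ∈ S_n^B`. -/
def ReducedB (n : ℕ) (w : List ℕ) (x : Equiv.Perm ℤ) : Prop :=
  IsWordBD n w ∧ prodB w = x ∧
    ∀ w' : List ℕ, IsWordBD n w' → prodB w' = x → w.length ≤ w'.length

/-- `w` is a reduced decomposition of `x ∈ S_n^D`. -/
def ReducedD (n : ℕ) (w : List ℕ) (x : Equiv.Perm ℤ) : Prop :=
  IsWordBD n w ∧ prodD w = x ∧
    ∀ w' : List ℕ, IsWordBD n w' → prodD w' = x → w.length ≤ w'.length

/-- Length in `S_n^B`. -/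
noncomputable def lenB (n : ℕ) (x : Equiv.Perm ℤ) : ℕ :=
  sInf {l | ∃ w : List ℕ, IsWordBD n w ∧ prodB w = x ∧ w.length = l}

/-- Length in `S_n^D`. -/
noncomputable def lenD (n : ℕ) (x : Equiv.Perm ℤ) : ℕ :=
  sInf {l | ∃ w : List ℕ, IsWordBD n w ∧ prodD w = x ∧ w.length = l}

/-- Bruhat order on `S_n^B`. -/
def bruhatB (n : ℕ) (v w : Equiv.Perm ℤ) : Prop :=
  ∃ a b : List ℕ, ReducedB n a v ∧ ReducedB n b w ∧ a.Sublist b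

/-- Bruhat order on `S_n^D`. -/
def bruhatD (n : ℕ) (v w : Equiv.Perm ℤ) : Prop :=
  ∃ a b : List ℕ, ReducedD n a v ∧ ReducedD n b w ∧ a.Sublist b

/-- `w` is an element of `S_n^B`: an "odd" permutation of `{±1, …, ±n}`. -/
def IsSignedPerm (n : ℕ) (w : Equiv.Perm ℤ) : Prop :=
  (∀ x : ℤ, w (-x) = - w x) ∧ ∀ x : ℤ, (n : ℤ) < |x| → w x = x

/-- `w` is an element of `S_n^D`: a signed permutation with an even number of
negative values in its one-line notation. -/
def IsTypeD (n : ℕ) (w : Equiv.Perm ℤ) : Prop :=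
  IsSignedPerm n w ∧ Even (((Finset.Icc (1 : ℤ) n).filter (fun x => w x < 0)).card)

/-- `w ∈ S_n^B` is boolean (for the type `B` Bruhat order). -/
def BooleanB (n : ℕ) (w : Equiv.Perm ℤ) : Prop :=
  ∃ (r : ℕ) (e : {v : Equiv.Perm ℤ // bruhatB n v w} ≃ Finset (Fin r)),
    ∀ a b : {v : Equiv.Perm ℤ // bruhatB n v w}, bruhatB n a.1 b.1 ↔ e a ⊆ e b

/-- `w ∈ S_n^D` is boolean (for the type `D` Bruhat order). -/
def BooleanD (n : ℕ) (w : Equiv.Perm ℤ) : Prop :=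
  ∃ (r : ℕ) (e : {v : Equiv.Perm ℤ // bruhatD n v w} ≃ Finset (Fin r)),
    ∀ a b : {v : Equiv.Perm ℤ // bruhatD n v w}, bruhatD n a.1 b.1 ↔ e a ⊆ e b

/-- Signed pattern containment, where the pattern is given by its one-line
notation `p` (a list of nonzero integers): there are positions
`1 ≤ f 0 < ⋯ < f (k-1) ≤ n` such that each `w (f j)` has the same sign as the
`j`-th entry of `p`, and the absolute values appear in the same relative order. -/
def containsPat (n : ℕ) (w : Equiv.Perm ℤ) (p : List ℤ) : Prop :=
  ∃ f : Fin p.length → ℤ, StrictMono f ∧ (∀ j, 1 ≤ f j ∧ f j ≤ (n : ℤ)) ∧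
    (∀ j, 0 < w (f j) ↔ 0 < p.get j) ∧
    (∀ j j', |w (f j)| < |w (f j')| ↔ |p.get j| < |p.get j'|)

/-- Signed pattern avoidance. -/
def avoidsPat (n : ℕ) (w : Equiv.Perm ℤ) (p : List ℤ) : Prop := ¬ containsPat n w p


/-! ### Extra definitions used in some statements -/

/-- `w ∈ S_n` is decomposable: `B(w) ≅ B(u) × B(v)` (as posets under Bruhat order)
for some `u ∈ S_m`, `v ∈ S_{m'}` with `m, m' < n`. -/
def Decomposable (n : ℕ) (w : Equiv.Perm (Fin n)) : Prop :=
  ∃ (m m' : ℕ), m < n ∧ m' < n ∧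
    ∃ (u : Equiv.Perm (Fin m)) (v : Equiv.Perm (Fin m'))
      (e : {x : Equiv.Perm (Fin n) // bruhatA n x w} ≃
        {y : Equiv.Perm (Fin m) // bruhatA m y u} × {z : Equiv.Perm (Fin m') // bruhatA m' z v}),
      ∀ a b : {x : Equiv.Perm (Fin n) // bruhatA n x w},
        bruhatA n a.1 b.1 ↔
          (bruhatA m ((e a).1).1 ((e b).1).1 ∧ bruhatA m' ((e a).2).1 ((e b).2).1)

/-- `w` is decreasing on the set of positions `T`. -/
def DecrOn (n : ℕ) (w : Equiv.Perm (Fin n)) (T : Finset (Fin n)) : Prop :=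
  ∀ a ∈ T, ∀ b ∈ T, a < b → w b < w a

/-- Every inversion of `w` lies in exactly one occurrence of the decreasing
pattern `w_0^{(k)}`: for every `i < j` with `w i > w j` there is exactly one
`k`-element set of positions containing `i` and `j` on which `w` is decreasing. -/
def EveryInvOnce (n k : ℕ) (w : Equiv.Perm (Fin n)) : Prop :=
  ∀ i j : Fin n, i < j → w j < w i →
    ∃! T : Finset (Fin n), T.card = k ∧ DecrOn n w T ∧ i ∈ T ∧ j ∈ T

/-- Equality of two patterns of (possibly a priori different) sizes. -/
def EqPat {k m : ℕ} (p : Equiv.Perm (Fin k)) (q : Equiv.Perm (Fin m)) : Prop :=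
  ∃ h : k = m, ∀ i : Fin k, ((p i : ℕ) = (q (Fin.cast h i) : ℕ))

/-- `L(n,k)`: the number of boolean permutations in `S_n` of length `k`. -/
noncomputable def LA (n k : ℕ) : ℕ :=
  Nat.card {w : Equiv.Perm (Fin n) // BooleanA n w ∧ lenA n w = k}

/-- `L` extended to integer arguments, with the convention that it vanishes
when `m < 1` or `j < 0`. -/
noncomputable def Lz (m j : ℤ) : ℤ :=
  if 1 ≤ m ∧ 0 ≤ j then (LA m.toNat j.toNat : ℤ) else 0

/-- `L^D(n,k)`: the number of boolean elements of `S_n^D` of length `k`. -/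
noncomputable def LD (n k : ℕ) : ℕ :=
  Nat.card {w : Equiv.Perm ℤ // IsTypeD n w ∧ BooleanD n w ∧ lenD n w = k}

/-! ### Inversions and the Lehmer code -/

/-- The set of inversions (as pairs of positions). -/
def invSet {n : ℕ} (w : Equiv.Perm (Fin n)) : Finset (Fin n × Fin n) :=
  Finset.univ.filter (fun p => p.1 < p.2 ∧ w p.2 < w p.1)

/-- The number of entries to the left of position `j` that are larger than `w j`. -/
def code {n : ℕ} (w : Equiv.Perm (Fin n)) (j : Fin n) : ℕ :=
  (Finset.univ.filter (fun i => i < j ∧ w j < w i)).card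

theorem mem_invSet {n : ℕ} (w : Equiv.Perm (Fin n)) (x y : Fin n) :
    (x, y) ∈ invSet w ↔ x < y ∧ w y < w x := by
  simp [invSet]

theorem card_invSet {n : ℕ} (w : Equiv.Perm (Fin n)) :
    (invSet w).card = ∑ j, code w j := by
  unfold invSet code
  simp only [Finset.card_filter]
  rw [Fintype.sum_prod_type, Finset.sum_comm]

theorem code_le {n : ℕ} (w : Equiv.Perm (Fin n)) (j : Fin n) : code w j ≤ j := by
  unfold code
  calc _ ≤ (Finset.Iio j).card := Finset.card_le_card (by
        intro i hi
        simp only [Finset.mem_filter, Finset.mem_univ, true_and] at hi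
        simpa using hi.1)
    _ = j := by simp

theorem code_inj {n : ℕ} {v w : Equiv.Perm (Fin n)} (h : ∀ j, code v j = code w j) : v = w := by
  have key : ∀ (v w : Equiv.Perm (Fin n)) (j : Fin n), (∀ j, code v j = code w j) →
      (∀ i, j < i → v i = w i) → ¬ v j < w j := by
    intro v w j h hi hlt
    have hsub : ((Finset.univ.filter (fun i => i < j ∧ w j < w i)).image w) ⊂
        ((Finset.univ.filter (fun i => i < j ∧ v j < v i)).image v) := by
      rw [Finset.ssubset_iff_of_subset]
      · refine ⟨w j, ?_, ?_⟩
        · simp only [Finset.mem_image, Finset.mem_filter, Finset.mem_univ, true_and]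
          refine ⟨v.symm (w j), ⟨?_, by simpa using hlt⟩, by simp⟩
          rcases lt_trichotomy (v.symm (w j)) j with h1 | h1 | h1
          · exact h1
          · rw [Equiv.symm_apply_eq] at h1
            exact absurd h1 hlt.ne'
          · have := hi _ h1
            rw [Equiv.apply_symm_apply] at this
            have := w.injective this
            exact absurd this h1.ne
        · simp
      · intro x
        simp only [Finset.mem_image, Finset.mem_filter, Finset.mem_univ, true_and]
        rintro ⟨i, ⟨hij, hw⟩, rfl⟩
        refine ⟨v.symm (w i), ⟨?_, by simpa using hlt.trans hw⟩, by simp⟩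
        rcases lt_trichotomy (v.symm (w i)) j with h1 | h1 | h1
        · exact h1
        · rw [Equiv.symm_apply_eq] at h1
          exact absurd (hlt.trans hw) (by rw [h1]; exact lt_irrefl _)
        · have := hi _ h1
          rw [Equiv.apply_symm_apply] at this
          have := w.injective this
          exact absurd (this ▸ h1) (not_lt.2 hij.le)
    have := Finset.card_lt_card hsub
    rw [Finset.card_image_of_injective _ w.injective,
      Finset.card_image_of_injective _ v.injective] at this
    exact absurd (h j) this.ne'
  have main : ∀ d : ℕ, ∀ j : Fin n, n - (j : ℕ) ≤ d → v j = w j := by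
    intro d
    induction d with
    | zero => intro j hj; omega
    | succ d ih =>
      intro j hj
      have hi : ∀ i, j < i → v i = w i := fun i hi => ih i (by
        have : (j : ℕ) < i := hi
        omega)
      exact le_antisymm (not_lt.1 (key w v j (fun j => (h j).symm) fun i h => (hi i h).symm))
        (not_lt.1 (key v w j h hi))
  ext j
  rw [main n j (by omega)]

theorem code_surj {n : ℕ} (c : Fin n → ℕ) (hc : ∀ j, c j ≤ j) :
    ∃ w : Equiv.Perm (Fin n), ∀ j, code w j = c j := by
  let F : Equiv.Perm (Fin n) → (∀ j : Fin n, Fin ((j : ℕ) + 1)) :=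
    fun w j => ⟨code w j, Nat.lt_succ_of_le (code_le w j)⟩
  have hF : Function.Bijective F := by
    rw [Fintype.bijective_iff_injective_and_card]
    constructor
    · intro v w h
      refine code_inj fun j => ?_
      have := congrFun h j
      simpa [F] using this
    · rw [Fintype.card_perm, Fintype.card_pi]
      simp only [Fintype.card_fin]
      rw [Fin.prod_univ_eq_prod_range (fun i => i + 1) n, Finset.prod_range_add_one_eq_factorial]
  obtain ⟨w, hw⟩ := hF.2 (fun j => ⟨c j, Nat.lt_succ_of_le (hc j)⟩)
  refine ⟨w, fun j => ?_⟩
  have := congrFun hw j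
  simpa [F] using this

/-! ### Length equals number of inversions -/

theorem card_invSet_mul_swap {n : ℕ} (w : Equiv.Perm (Fin n)) (a b : Fin n)
    (hab : (a : ℕ) + 1 = b) (hw : w b < w a) :
    (invSet w).card = (invSet (w * Equiv.swap a b)).card + 1 := by
  have hlt : a < b := by rw [Fin.lt_def]; omega
  have hmem : (a, b) ∈ invSet w := by simp [invSet, hlt, hw]
  have hmono : ∀ x y : Fin n, x < y → (x, y) ≠ (a, b) → Equiv.swap a b x < Equiv.swap a b y := by
    intro x y hxy hne
    simp only [Equiv.swap_apply_def]
    have hne' : ¬ (x = a ∧ y = b) := by simpa using hne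
    simp only [Fin.ext_iff, Fin.lt_def] at *
    split_ifs <;> omega
  rw [← Finset.card_erase_add_one hmem]
  congr 1
  refine Finset.card_bij' (fun p _ => (Equiv.swap a b p.1, Equiv.swap a b p.2))
    (fun p _ => (Equiv.swap a b p.1, Equiv.swap a b p.2)) ?_ ?_ ?_ ?_
  · rintro ⟨x, y⟩ h
    simp only [Finset.mem_erase, mem_invSet] at h
    simp only [mem_invSet, Equiv.Perm.mul_apply,
      Equiv.swap_apply_self]
    exact ⟨hmono x y h.2.1 h.1, h.2.2⟩
  · rintro ⟨x, y⟩ h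
    simp only [mem_invSet, Equiv.Perm.mul_apply] at h
    simp only [Finset.mem_erase, mem_invSet]
    have hne : (x, y) ≠ (a, b) := by
      intro e
      obtain ⟨rfl, rfl⟩ := Prod.mk.inj e
      have := h.2
      rw [Equiv.swap_apply_left, Equiv.swap_apply_right] at this
      exact lt_asymm this hw
    refine ⟨?_, hmono x y h.1 hne, h.2⟩
    intro e
    obtain ⟨e1, e2⟩ := Prod.mk.inj e
    rw [Equiv.swap_apply_eq_iff, Equiv.swap_apply_left] at e1
    rw [Equiv.swap_apply_eq_iff, Equiv.swap_apply_right] at e2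
    subst e1 e2
    exact lt_asymm h.1 hlt
  · rintro ⟨x, y⟩ _
    simp
  · rintro ⟨x, y⟩ _
    simp

theorem card_invSet_mul_sA_le {n : ℕ} (w : Equiv.Perm (Fin n)) (i : ℕ) :
    (invSet (w * sA n i)).card ≤ (invSet w).card + 1 := by
  unfold sA
  split_ifs with h
  · set a : Fin n := ⟨i - 1, by omega⟩ with ha
    set b : Fin n := ⟨i, h.2⟩ with hb
    have hab : (a : ℕ) + 1 = b := by simp [ha, hb]; omega
    have hne : a ≠ b := by
      intro e
      rw [e] at hab
      omega
    rcases lt_or_gt_of_ne (w.injective.ne hne) with h1 | h1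
    · have := card_invSet_mul_swap (w * Equiv.swap a b) a b hab (by simpa using h1)
      rw [mul_assoc, Equiv.swap_mul_self, mul_one] at this
      exact this.le
    · have := card_invSet_mul_swap w a b hab h1
      omega
  · simp

theorem card_invSet_prodA_le {n : ℕ} (l : List ℕ) : (invSet (prodA n l)).card ≤ l.length := by
  induction l using List.reverseRecOn with
  | nil =>
    have : invSet (prodA n []) = ∅ := by
      simp only [invSet, prodA, List.map_nil, List.prod_nil, Equiv.Perm.one_apply]
      rw [Finset.filter_eq_empty_iff]
      intro p _ h
      exact lt_asymm h.1 h.2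
    simp [this]
  | append_singleton l i ih =>
    have : prodA n (l ++ [i]) = prodA n l * sA n i := by simp [prodA]
    rw [this, List.length_append, List.length_singleton]
    exact (card_invSet_mul_sA_le _ _).trans (by omega)

theorem exists_descent {n : ℕ} (w : Equiv.Perm (Fin n)) (hw : w ≠ 1) :
    ∃ a b : Fin n, (a : ℕ) + 1 = b ∧ w b < w a := by
  by_contra hcon
  push Not at hcon
  apply hw
  cases n with
  | zero => exact Subsingleton.elim _ _
  | succ m =>
    have hm : StrictMono w := by
      rw [Fin.strictMono_iff_lt_succ]
      intro i
      exact lt_of_le_of_ne (hcon _ _ (by simp)) (w.injective.ne (Fin.castSucc_lt_succ).ne)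
    have := Subsingleton.elim (StrictMono.orderIsoOfSurjective w hm w.surjective)
      (OrderIso.refl (Fin (m + 1)))
    ext x
    have h2 := congrArg (fun e => e x) this
    simpa using congrArg Fin.val h2

theorem exists_word {n : ℕ} (d : ℕ) : ∀ w : Equiv.Perm (Fin n), (invSet w).card = d →
    ∃ l : List ℕ, IsWordA n l ∧ prodA n l = w ∧ l.length = d := by
  induction d with
  | zero =>
    intro w hw
    refine ⟨[], by simp [IsWordA], ?_, rfl⟩
    by_contra hne
    have hne' : w ≠ 1 := by
      intro e
      exact hne (by simp [prodA, e])
    obtain ⟨a, b, hab, h⟩ := exists_descent w hne'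
    have := card_invSet_mul_swap w a b hab h
    omega
  | succ d ih =>
    intro w hw
    have hne' : w ≠ 1 := by
      intro e
      have := card_invSet_prodA_le (n := n) []
      simp only [prodA, List.map_nil, List.prod_nil, List.length_nil] at this
      rw [e] at hw
      omega
    obtain ⟨a, b, hab, h⟩ := exists_descent w hne'
    have h1 := card_invSet_mul_swap w a b hab h
    obtain ⟨l, hl, hp, hlen⟩ := ih (w * Equiv.swap a b) (by omega)
    have hb := b.2
    refine ⟨l ++ [(b : ℕ)], ?_, ?_, by simp [hlen]⟩
    · intro i hi
      rw [List.mem_append, List.mem_singleton] at hi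
      rcases hi with hi | rfl
      · exact hl i hi
      · omega
    · have : prodA n (l ++ [(b : ℕ)]) = prodA n l * sA n b := by simp [prodA]
      have hs : sA n b = Equiv.swap a b := by
        unfold sA
        rw [dif_pos ⟨by omega, hb⟩]
        congr 1
        ext
        simp
        omega
      rw [this, hp, hs, mul_assoc, Equiv.swap_mul_self, mul_one]

theorem lenA_eq {n : ℕ} (w : Equiv.Perm (Fin n)) : lenA n w = (invSet w).card := by
  unfold lenA
  apply le_antisymm
  · exact Nat.sInf_le (exists_word _ w rfl)
  · apply le_csInf
    · exact ⟨_, exists_word _ w rfl⟩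
    · rintro l ⟨u, _, rfl, rfl⟩
      exact card_invSet_prodA_le u

theorem lenA_inv {n : ℕ} (w : Equiv.Perm (Fin n)) : lenA n w⁻¹ = lenA n w := by
  rw [lenA_eq, lenA_eq]
  refine Finset.card_bij' (fun p _ => (w⁻¹ p.2, w⁻¹ p.1)) (fun p _ => (w p.2, w p.1)) ?_ ?_ ?_ ?_
  · rintro ⟨x, y⟩ h
    simp only [invSet, Finset.mem_filter, Finset.mem_univ, true_and] at h ⊢
    exact ⟨h.2, by simpa using h.1⟩
  · rintro ⟨x, y⟩ h
    simp only [invSet, Finset.mem_filter, Finset.mem_univ, true_and] at h ⊢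
    exact ⟨h.2, by simpa using h.1⟩
  · rintro ⟨x, y⟩ _
    simp
  · rintro ⟨x, y⟩ _
    simp

/-! ### Pattern containment -/

theorem contains_of {n : ℕ} (w : Equiv.Perm (Fin n)) (p : Equiv.Perm (Fin 3)) (x y z : Fin n)
    (hxy : x < y) (hyz : y < z)
    (h : ∀ a b : Fin 3, p a < p b → w (![x, y, z] a) < w (![x, y, z] b)) : ContainsA w p := by
  refine ⟨![x, y, z], ?_, fun a b => ⟨fun hab => ?_, h a b⟩⟩
  · rw [Fin.strictMono_iff_lt_succ]
    intro i
    fin_cases i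
    · exact hxy
    · exact hyz
  · by_contra hcon
    rcases (not_lt.1 hcon).lt_or_eq with h1 | h1
    · exact lt_asymm hab (h _ _ h1)
    · rw [p.injective h1] at hab
      exact lt_irrefl _ hab

theorem contains_inv {n k : ℕ} (w : Equiv.Perm (Fin n)) (p q : Equiv.Perm (Fin k))
    (hq : q = p⁻¹) (h : ContainsA w p) : ContainsA w⁻¹ q := by
  subst hq
  obtain ⟨f, hf, hw⟩ := h
  refine ⟨fun a => w (f (p⁻¹ a)), ?_, ?_⟩
  · intro a b hab
    rw [hw]
    simpa using hab
  · intro a b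
    simp [hf.lt_iff_lt]

theorem avoids_inv_iff {n k : ℕ} (w : Equiv.Perm (Fin n)) (p q : Equiv.Perm (Fin k))
    (hq : q = p⁻¹) : AvoidsA w⁻¹ q ↔ AvoidsA w p := by
  unfold AvoidsA
  rw [not_iff_not]
  refine ⟨fun h => ?_, contains_inv w p q hq⟩
  have := contains_inv w⁻¹ q p (by rw [hq, inv_inv]) h
  rwa [inv_inv] at this

theorem avoids_iff_code {n : ℕ} (w : Equiv.Perm (Fin n)) :
    (AvoidsA w p321 ∧ AvoidsA w p231) ↔ ∀ j, code w j ≤ 1 := by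
  constructor
  · rintro ⟨h1, h2⟩ j
    by_contra hcon
    unfold code at hcon
    rw [not_le, Finset.one_lt_card] at hcon
    obtain ⟨x, hx, y, hy, hxy⟩ := hcon
    simp only [Finset.mem_filter, Finset.mem_univ, true_and] at hx hy
    wlog hlt : x < y generalizing x y
    · exact this y x hxy.symm hy hx (lt_of_le_of_ne (not_lt.1 hlt) hxy.symm)
    rcases lt_or_gt_of_ne (w.injective.ne hxy) with h | h
    · apply h2
      refine contains_of w p231 x y j hlt hy.1 ?_
      intro a b hab
      fin_cases a <;> fin_cases b <;> first
        | exact absurd hab (by decide)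
        | exact h
        | exact hx.2
        | exact hy.2
    · apply h1
      refine contains_of w p321 x y j hlt hy.1 ?_
      intro a b hab
      fin_cases a <;> fin_cases b <;> first
        | exact absurd hab (by decide)
        | exact h
        | exact hx.2
        | exact hy.2
  · intro h
    have key : ∀ p : Equiv.Perm (Fin 3), p 2 < p 0 → p 2 < p 1 → AvoidsA w p := by
      rintro p h0 h1 ⟨f, hf, hw⟩
      have := h (f 2)
      revert this
      unfold code
      rw [imp_false, not_le, Finset.one_lt_card]
      refine ⟨f 0, ?_, f 1, ?_, (hf (by decide)).ne⟩
      · simp only [Finset.mem_filter, Finset.mem_univ, true_and]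
        exact ⟨hf (by decide), (hw _ _).2 h0⟩
      · simp only [Finset.mem_filter, Finset.mem_univ, true_and]
        exact ⟨hf (by decide), (hw _ _).2 h1⟩
    exact ⟨key _ (by decide) (by decide), key _ (by decide) (by decide)⟩

theorem lenA_eq_card {m : ℕ} (w : Equiv.Perm (Fin (m + 1))) (h : ∀ j, code w j ≤ 1) :
    lenA (m + 1) w = (Finset.univ.filter (fun j : Fin m => code w j.succ = 1)).card := by
  rw [lenA_eq, card_invSet, Fin.sum_univ_succ, Finset.card_filter]
  have h0 : code w 0 = 0 := Nat.le_zero.1 (code_le w 0)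
  rw [h0, zero_add]
  refine Finset.sum_congr rfl fun j _ => ?_
  have := h j.succ
  split_ifs <;> omega

theorem card_first (m k : ℕ) :
    Nat.card {w : Equiv.Perm (Fin (m + 1)) //
      lenA (m + 1) w = k ∧ AvoidsA w p321 ∧ AvoidsA w p231} = Nat.choose m k := by
  have e : Nat.card {S : Finset (Fin m) // S.card = k} = Nat.choose m k := by
    rw [Nat.card_eq_fintype_card, Fintype.card_finset_len, Fintype.card_fin]
  rw [← e]
  refine Nat.card_eq_of_bijective (fun w =>
    ⟨Finset.univ.filter (fun j : Fin m => code w.1 j.succ = 1), ?_⟩) ⟨?_, ?_⟩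
  · rw [← lenA_eq_card w.1 ((avoids_iff_code _).1 w.2.2)]
    exact w.2.1
  · rintro ⟨v, hv⟩ ⟨w, hw⟩ h
    have hv' := (avoids_iff_code _).1 hv.2
    have hw' := (avoids_iff_code _).1 hw.2
    simp only [Subtype.mk.injEq, Finset.ext_iff, Finset.mem_filter, Finset.mem_univ,
      true_and] at h
    rw [Subtype.mk.injEq]
    refine code_inj fun j => ?_
    refine Fin.cases ?_ (fun j => ?_) j
    · rw [Nat.le_zero.1 (code_le v 0), Nat.le_zero.1 (code_le w 0)]
    · have := h j
      have := hv' j.succ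
      have := hw' j.succ
      omega
  · rintro ⟨S, hS⟩
    obtain ⟨w, hw⟩ := code_surj (Fin.cons 0 (fun j : Fin m => if j ∈ S then 1 else 0)) (by
      intro j
      refine Fin.cases ?_ (fun j => ?_) j
      · simp
      · simp only [Fin.cons_succ, Fin.val_succ]
        split_ifs <;> omega)
    have hs : ∀ j : Fin m, code w j.succ = if j ∈ S then 1 else 0 := fun j => by
      rw [hw, Fin.cons_succ]
    have h1 : ∀ j, code w j ≤ 1 := by
      intro j
      refine Fin.cases ?_ (fun j => ?_) j
      · rw [hw]; simp
      · rw [hs]; split_ifs <;> omega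
    have hset : Finset.univ.filter (fun j : Fin m => code w j.succ = 1) = S := by
      ext j
      simp [hs]
    refine ⟨⟨w, ?_, (avoids_iff_code _).2 h1⟩, ?_⟩
    · rw [lenA_eq_card w h1, hset, hS]
    · exact Subtype.ext hset

theorem card_second (n k : ℕ) :
    Nat.card {w : Equiv.Perm (Fin n) // lenA n w = k ∧ AvoidsA w p321 ∧ AvoidsA w p312} =
    Nat.card {w : Equiv.Perm (Fin n) // lenA n w = k ∧ AvoidsA w p321 ∧ AvoidsA w p231} := by
  refine Nat.card_congr (Equiv.subtypeEquiv (Equiv.inv _) fun w => ?_)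
  rw [Equiv.inv_apply, lenA_inv, avoids_inv_iff w p321 p321 (by decide),
    avoids_inv_iff w p312 p231 (by decide)]

theorem stmt14 (n k : ℕ) (hn : 2 ≤ n) :
    Nat.card {w : Equiv.Perm (Fin n) // lenA n w = k ∧ AvoidsA w p321 ∧ AvoidsA w p231} =
      Nat.choose (n - 1) k ∧
    Nat.card {w : Equiv.Perm (Fin n) // lenA n w = k ∧ AvoidsA w p321 ∧ AvoidsA w p312} =
      Nat.choose (n - 1) k := by
  obtain ⟨m, rfl⟩ : ∃ m, n = m + 1 := ⟨n - 1, by omega⟩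
  rw [card_second, Nat.add_sub_cancel]
  exact ⟨card_first m k, card_first m k⟩

end Paper
end

section
/- For n ≥ 2, the set of permutations in S_n avoiding both 321 and 231 equals the principal Bruhat order ideal B(w) of the permutation w = n 1 2 ··· (n−1) (one-line notation), and the set of permutations in S_n avoiding both 321 and 312 equals the principal Bruhat order ideal B(w') of the permutation w' = 2 3 ··· n 1. -/
namespace Paper

theorem sA_val (n i : ℕ) (hi : 1 ≤ i) (hin : i < n) (x : Fin n) :
    ((sA n i x : Fin n) : ℕ) = if (x : ℕ) = i - 1 then i else if (x : ℕ) = i then i - 1 else x := by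
  unfold sA
  rw [dif_pos ⟨hi, hin⟩, Equiv.swap_apply_def]
  simp only [Fin.ext_iff]
  split_ifs <;> rfl

theorem sA_mul_self (n i : ℕ) : sA n i * sA n i = 1 := by
  unfold sA
  split_ifs <;> simp

theorem prodA_cons (n c : ℕ) (a : List ℕ) : prodA n (c :: a) = sA n c * prodA n a := by
  simp [prodA]

theorem prodA_append (n : ℕ) (a b : List ℕ) : prodA n (a ++ b) = prodA n a * prodA n b := by
  simp [prodA]

theorem prodA_reverse (n : ℕ) (a : List ℕ) : prodA n a.reverse = (prodA n a)⁻¹ := by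
  induction a with
  | nil => simp [prodA]
  | cons c a ih =>
    rw [List.reverse_cons, prodA_append, ih, prodA_cons, prodA_cons n c a, mul_inv_rev]
    have : (sA n c)⁻¹ = sA n c := inv_eq_of_mul_eq_one_left (sA_mul_self n c)
    rw [this]; simp [prodA]

theorem IsWordA_cons {n c : ℕ} {a : List ℕ} :
    IsWordA n (c :: a) ↔ (1 ≤ c ∧ c ≤ n - 1) ∧ IsWordA n a := by
  simp [IsWordA]

theorem IsWordA_reverse {n : ℕ} {a : List ℕ} : IsWordA n a.reverse ↔ IsWordA n a := by
  simp [IsWordA]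

theorem ReducedA_reverse {n : ℕ} {a : List ℕ} {v : Equiv.Perm (Fin n)} (h : ReducedA n a v) :
    ReducedA n a.reverse v⁻¹ := by
  obtain ⟨h1, h2, h3⟩ := h
  refine ⟨IsWordA_reverse.2 h1, by rw [prodA_reverse, h2], fun w' hw hp => ?_⟩
  have := h3 w'.reverse (IsWordA_reverse.2 hw) (by rw [prodA_reverse, hp, inv_inv])
  simpa using this

theorem bruhatA_inv {n : ℕ} {v w : Equiv.Perm (Fin n)} (h : bruhatA n v w) :
    bruhatA n v⁻¹ w⁻¹ := by
  obtain ⟨a, b, ha, hb, hab⟩ := h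
  exact ⟨_, _, ReducedA_reverse ha, ReducedA_reverse hb, hab.reverse⟩

theorem ContainsA_inv {n k : ℕ} {v : Equiv.Perm (Fin n)} {p : Equiv.Perm (Fin k)}
    (h : ContainsA v p) : ContainsA v⁻¹ p⁻¹ := by
  obtain ⟨f, hf, h⟩ := h
  refine ⟨fun a => v (f (p⁻¹ a)), fun a b hab => ?_, fun a b => ?_⟩
  · rw [h]; simpa using hab
  · simp [hf.lt_iff_lt]

/-- A word moving `x` down to `y` has length at least `x - y`, with a unique word in case of
equality. -/
theorem word_down (n : ℕ) (b : List ℕ) (hb : IsWordA n b) (x : Fin n) :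
    (x : ℕ) ≤ (prodA n b x : Fin n) + b.length ∧
      ((x : ℕ) = (prodA n b x : Fin n) + b.length →
        b = List.range' ((prodA n b x : Fin n) + 1) b.length) := by
  induction b with
  | nil => simp [prodA]
  | cons c b ih =>
    obtain ⟨hc, hb⟩ := IsWordA_cons.1 hb
    obtain ⟨ih1, ih2⟩ := ih hb
    have hn : 0 < n := x.pos
    rw [prodA_cons, Equiv.Perm.mul_apply, sA_val n c hc.1 (by omega)]
    rw [List.length_cons, List.range'_succ]
    generalize ((prodA n b x : Fin n) : ℕ) = z at *
    constructor
    · split_ifs <;> omega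
    · intro h
      have hz : z = c := by split_ifs at h <;> omega
      subst hz
      have e : (if z = z - 1 then z else if z = z then z - 1 else z) + 1 = z := by
        split_ifs <;> omega
      rw [e]
      congr 1
      apply ih2
      split_ifs at h <;> omega

theorem prod_fix (n : ℕ) (a : List ℕ) (ha : IsWordA n a) (y : Fin n)
    (h : ∀ i ∈ a, (y : ℕ) + 1 < i) : prodA n a y = y := by
  induction a with
  | nil => simp [prodA]
  | cons c a ih =>
    obtain ⟨hc, ha⟩ := IsWordA_cons.1 ha
    have := h c (by simp)
    have hn := y.pos
    rw [prodA_cons, Equiv.Perm.mul_apply, ih ha (fun i hi => h i (by simp [hi]))]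
    apply Fin.ext
    rw [sA_val n c hc.1 (by omega)]
    split_ifs <;> omega

theorem prod_preserve (n k : ℕ) (a : List ℕ) (ha : IsWordA n a) (y : Fin n)
    (h : k ∉ a) : (prodA n a y : ℕ) < k ↔ (y : ℕ) < k := by
  induction a with
  | nil => simp [prodA]
  | cons c a ih =>
    obtain ⟨hc, ha⟩ := IsWordA_cons.1 ha
    have hn := y.pos
    simp only [List.mem_cons, not_or] at h
    rw [← ih ha h.2, prodA_cons, Equiv.Perm.mul_apply, sA_val n c hc.1 (by omega)]
    split_ifs <;> omega

theorem prod_le (n : ℕ) (a : List ℕ) (ha : IsWordA n a) (hs : a.Pairwise (· < ·)) (x : Fin n) :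
    (prodA n a x : ℕ) ≤ x + 1 := by
  induction a with
  | nil => simp [prodA]
  | cons c a ih =>
    obtain ⟨hc, ha⟩ := IsWordA_cons.1 ha
    have hn := x.pos
    rw [List.pairwise_cons] at hs
    have ih := ih ha hs.2
    rw [prodA_cons, Equiv.Perm.mul_apply, sA_val n c hc.1 (by omega)]
    split_ifs with h1 h2
    · have hf := prod_fix n a ha ⟨c - 1, by omega⟩ (fun i hi => by
        have := hs.1 i hi
        simp only; omega)
      have : prodA n a x = prodA n a ⟨c - 1, by omega⟩ := by
        rw [hf]; exact Fin.ext h1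
      have := congrArg Fin.val ((prodA n a).injective this)
      simp only at this
      omega
    · omega
    · omega

theorem sorted_reduced (n : ℕ) (a : List ℕ) (ha : IsWordA n a) (hs : a.Pairwise (· < ·)) :
    ReducedA n a (prodA n a) := by
  refine ⟨ha, rfl, fun w' hw hp => ?_⟩
  have hsub : a ⊆ w' := by
    intro i hi
    by_contra hi'
    have hil := ha i hi
    obtain ⟨x, z, rfl⟩ := List.append_of_mem hi
    rw [List.pairwise_append, List.pairwise_cons] at hs
    obtain ⟨hs1, ⟨hs2, hs3⟩, hs4⟩ := hs
    have hx : IsWordA n x := fun j hj => ha j (by simp [hj])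
    have hz : IsWordA n z := fun j hj => ha j (by simp [hj])
    have h1 := (prod_preserve n i w' hw ⟨i - 1, by omega⟩ hi').2 (by simp only; omega)
    rw [hp, prodA_append, prodA_cons, Equiv.Perm.mul_apply, Equiv.Perm.mul_apply,
      prod_fix n z hz _ (fun j hj => by have := hs2 j hj; simp only; omega),
      prod_preserve n i x hx _ (fun h => by have := hs4 i h i (by simp); omega),
      sA_val n i hil.1 (by omega)] at h1
    simp at h1
  have hnd : a.Nodup := hs.imp (fun h => Nat.ne_of_lt h)
  exact (List.subperm_of_subset hnd hsub).length_le

theorem exists_word_s15 (n : ℕ) (m c : ℕ) (hc : c + m + 1 = n) (v : Equiv.Perm (Fin n))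
    (hv : ∀ i, (v i : ℕ) ≤ i + 1) (hf : ∀ i : Fin n, (i : ℕ) < c → v i = i) :
    ∃ a : List ℕ, a.Sublist (List.range' (c + 1) m) ∧ prodA n a = v := by
  induction m generalizing c v with
  | zero =>
    refine ⟨[], by simp, ?_⟩
    ext i
    simp only [prodA, List.map_nil, List.prod_nil, Equiv.Perm.one_apply]
    by_cases hi : (i : ℕ) < c
    · rw [hf i hi]
    · by_contra hne
      have hlt : (v i : ℕ) < c := by have := (v i).isLt; have := i.isLt; omega
      have := v.injective (hf (v i) hlt)
      exact hne (by rw [this])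
  | succ m ih =>
    have hcn : c < n := by omega
    have hcc : c ≤ (v ⟨c, hcn⟩ : ℕ) := by
      by_contra hlt
      have := v.injective (hf (v ⟨c, hcn⟩) (by omega))
      have := congrArg Fin.val this
      simp only at this
      omega
    have hcc' := hv ⟨c, hcn⟩
    simp only at hcc'
    rw [List.range'_succ]
    by_cases he : (v ⟨c, hcn⟩ : ℕ) = c
    · obtain ⟨a, h1, h2⟩ := ih (c + 1) (by omega) v hv (fun i hi => by
        rcases Nat.lt_succ_iff_lt_or_eq.1 hi with h | h
        · exact hf i h
        · have : i = ⟨c, hcn⟩ := Fin.ext h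
          subst this
          exact Fin.ext he)
      exact ⟨a, h1.cons _, h2⟩
    · have he : (v ⟨c, hcn⟩ : ℕ) = c + 1 := by omega
      have hval : ∀ i, (((sA n (c + 1) * v) i : Fin n) : ℕ) =
          if (v i : ℕ) = c then c + 1 else if (v i : ℕ) = c + 1 then c else v i := by
        intro i
        rw [Equiv.Perm.mul_apply, sA_val n (c + 1) (by omega) (by omega)]
        simp
      obtain ⟨a, h1, h2⟩ := ih (c + 1) (by omega) (sA n (c + 1) * v) (fun i => by
          rw [hval]
          have := hv i
          split_ifs with h1 h2
          · by_contra hlt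
            have := hf i (by omega)
            have := congrArg Fin.val this
            omega
          · omega
          · omega) (fun i hi => by
          apply Fin.ext
          rw [hval]
          rcases Nat.lt_succ_iff_lt_or_eq.1 hi with h | h
          · rw [hf i h]
            split_ifs <;> omega
          · have : i = ⟨c, hcn⟩ := Fin.ext h
            subst this
            rw [he]
            simp)
      refine ⟨(c + 1) :: a, h1.cons_cons _, ?_⟩
      rw [prodA_cons, h2, ← mul_assoc, sA_mul_self, one_mul]

theorem avoid_iff (n : ℕ) (v : Equiv.Perm (Fin n)) :
    (AvoidsA v p321 ∧ AvoidsA v p312) ↔ ∀ i, (v i : ℕ) ≤ i + 1 := by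
  have key : (AvoidsA v p321 ∧ AvoidsA v p312) ↔
      ∀ i j k, i < j → j < k → v j < v i → v k < v i → False := by
    constructor
    · rintro ⟨h1, h2⟩ i j k hij hjk hj hk
      have hm : StrictMono ![i, j, k] := by
        intro a b hab
        fin_cases a <;> fin_cases b <;> simp at hab ⊢ <;> first | assumption | exact hij.trans hjk
      rcases lt_trichotomy (v j) (v k) with h | h | h
      · apply h2
        refine ⟨![i, j, k], hm, fun a b => ?_⟩
        fin_cases a <;> fin_cases b <;> simp [p312, hj, hk, h, hj.le, hk.le, h.le]
      · exact hjk.ne (v.injective h)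
      · apply h1
        refine ⟨![i, j, k], hm, fun a b => ?_⟩
        fin_cases a <;> fin_cases b <;> simp [p321, hj, hk, h, hj.le, hk.le, h.le]
    · intro h
      constructor
      · rintro ⟨f, hf, hp⟩
        exact h (f 0) (f 1) (f 2) (hf (by decide)) (hf (by decide)) ((hp _ _).2 (by decide))
          ((hp _ _).2 (by decide))
      · rintro ⟨f, hf, hp⟩
        exact h (f 0) (f 1) (f 2) (hf (by decide)) (hf (by decide)) ((hp _ _).2 (by decide))
          ((hp _ _).2 (by decide))
  rw [key]
  constructor
  · intro h i
    by_contra hlt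
    have hcard : 1 < (((Finset.Iio (v i)).map (v⁻¹).toEmbedding) \ Finset.Iio i).card := by
      have := Finset.le_card_sdiff (Finset.Iio i) ((Finset.Iio (v i)).map (v⁻¹).toEmbedding)
      rw [Finset.card_map, Fin.card_Iio, Fin.card_Iio] at this
      omega
    obtain ⟨x, hx, y, hy, hxy⟩ := Finset.one_lt_card.1 hcard
    have hmem : ∀ x, x ∈ (((Finset.Iio (v i)).map (v⁻¹).toEmbedding) \ Finset.Iio i) →
        v x < v i ∧ i < x := by
      intro x hx
      simp only [Finset.mem_sdiff, Finset.mem_map, Finset.mem_Iio, not_lt] at hx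
      obtain ⟨⟨z, hz, rfl⟩, hx⟩ := hx
      have : v (v⁻¹.toEmbedding z) = z := by simp
      rw [this]
      refine ⟨hz, lt_of_le_of_ne hx ?_⟩
      intro he
      rw [← he] at this
      rw [this] at hz
      exact lt_irrefl _ hz
    obtain ⟨hx1, hx2⟩ := hmem x hx
    obtain ⟨hy1, hy2⟩ := hmem y hy
    rcases lt_or_gt_of_ne hxy with hlt | hlt
    · exact h i x y hx2 hlt hx1 hy1
    · exact h i y x hy2 hlt hy1 hx1
  · intro h i j k hij hjk hj hk
    have hle := Finset.card_le_card_of_injOn (s := insert j (insert k (Finset.Iic i)))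
      (t := Finset.range (i + 2)) (fun x => (v x : ℕ)) (by
        intro x hx
        have := h i
        have := h x
        simp only [Finset.coe_insert, Finset.coe_Iic, Set.mem_insert_iff, Set.mem_Iic] at hx
        simp only [Finset.coe_range, Set.mem_Iio]
        rcases hx with rfl | rfl | hx
        · omega
        · omega
        · have : (x : ℕ) ≤ i := hx
          omega) (fun x _ y _ hxy => v.injective (Fin.ext hxy))
    rw [Finset.card_insert_of_notMem, Finset.card_insert_of_notMem, Fin.card_Iic,
      Finset.card_range] at hle
    · omega
    · simpa using hij.trans hjk
    · simp only [Finset.mem_insert, Finset.mem_Iic, not_or, not_le]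
      exact ⟨hjk.ne, hij⟩

theorem finRotate_val (n : ℕ) (x : Fin n) :
    ((finRotate n x : Fin n) : ℕ) = if (x : ℕ) + 1 = n then 0 else (x : ℕ) + 1 := by
  cases n with
  | zero => exact x.elim0
  | succ n =>
    rw [coe_finRotate]
    simp only [Fin.ext_iff, Fin.val_last]
    split_ifs <;> omega

theorem finRotate_last {n : ℕ} (hn : 2 ≤ n) :
    ((finRotate n ⟨n - 1, by omega⟩ : Fin n) : ℕ) = 0 := by
  rw [finRotate_val, if_pos]
  simp only; omega

theorem range_word (n : ℕ) : IsWordA n (List.range' 1 (n - 1)) := by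
  intro i hi
  rw [List.mem_range'_1] at hi
  omega

theorem prod_range {n : ℕ} (hn : 2 ≤ n) : prodA n (List.range' 1 (n - 1)) = finRotate n := by
  obtain ⟨a, h1, h2⟩ := exists_word_s15 n (n - 1) 0 (by omega) (finRotate n) (fun i => by
    rw [finRotate_val]; split_ifs <;> omega) (fun i hi => by omega)
  rw [zero_add] at h1
  have hw : IsWordA n a := fun i hi => range_word n i (h1.subset hi)
  have := (word_down n a hw ⟨n - 1, by omega⟩).1
  rw [h2, finRotate_last hn] at this
  have hl : a = List.range' 1 (n - 1) := h1.eq_of_length_le (by simpa using this)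
  rw [← hl, h2]

theorem bruhat_iff {n : ℕ} (hn : 2 ≤ n) (v : Equiv.Perm (Fin n)) :
    bruhatA n v (finRotate n) ↔ ∀ i, (v i : ℕ) ≤ i + 1 := by
  constructor
  · rintro ⟨a, b, ⟨ha, hav, -⟩, ⟨hb, hbw, hmin⟩, hab⟩
    have hl := hmin _ (range_word n) (prod_range hn)
    obtain ⟨h1, h2⟩ := word_down n b hb ⟨n - 1, by omega⟩
    rw [hbw, finRotate_last hn] at h1 h2
    rw [List.length_range'] at hl
    simp only at h1 h2
    have h2 := h2 (by omega)
    rw [h2] at hab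
    intro i
    rw [← hav]
    exact prod_le n a ha (List.Pairwise.sublist hab List.pairwise_lt_range') i
  · intro h
    obtain ⟨a, h1, h2⟩ := exists_word_s15 n (n - 1) 0 (by omega) v h (fun i hi => by omega)
    rw [zero_add] at h1
    have hw : IsWordA n a := fun i hi => range_word n i (h1.subset hi)
    refine ⟨a, _, ?_, ?_, h1⟩
    · rw [← h2]
      exact sorted_reduced n a hw (List.Pairwise.sublist h1 List.pairwise_lt_range')
    · rw [← prod_range hn]
      exact sorted_reduced n _ (range_word n) List.pairwise_lt_range'

theorem avoid_inv {n k : ℕ} (v : Equiv.Perm (Fin n)) (p : Equiv.Perm (Fin k)) :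
    AvoidsA v p ↔ AvoidsA v⁻¹ p⁻¹ := by
  refine not_congr ⟨ContainsA_inv, fun h => ?_⟩
  simpa using ContainsA_inv h

theorem stmt15 (n : ℕ) (hn : 2 ≤ n) :
    (∀ v : Equiv.Perm (Fin n),
      (AvoidsA v p321 ∧ AvoidsA v p231) ↔ bruhatA n v (finRotate n)⁻¹) ∧
    (∀ v : Equiv.Perm (Fin n),
      (AvoidsA v p321 ∧ AvoidsA v p312) ↔ bruhatA n v (finRotate n)) := by
  refine ⟨fun v => ?_, fun v => ?_⟩
  · have h1 : p321⁻¹ = p321 := by decide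
    have h2 : p231⁻¹ = p312 := by decide
    rw [avoid_inv v p321, avoid_inv v p231, h1, h2, avoid_iff, ← bruhat_iff hn]
    refine ⟨fun h => ?_, fun h => ?_⟩
    · simpa using bruhatA_inv h
    · simpa using bruhatA_inv h
  · rw [avoid_iff, bruhat_iff hn]


end Paper
end

section
/- A signed permutation w ∈ S_n^B is boolean (its principal Bruhat order ideal B(w) is order-isomorphic to a boolean lattice of subsets) if and only if w avoids all ten of the following signed patterns (written in one-line notation, with negative entries indicated by a minus sign): (−1)(−2); (−2)(−1); 3 2 1; 3 4 1 2; 3 2 (−1); 3 4 (−1) 2; (−3) 2 1; (−3) 4 1 2; 1 (−2); 3 (−2) 1. -/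
namespace Paper

lemma sB_zero_apply (x : ℤ) : sB 0 x = if x = 1 then -1 else if x = -1 then 1 else x := by
  simp [sB, Equiv.swap_apply_def]

lemma sB_succ_apply (i : ℕ) (x : ℤ) : sB (i+1) x =
    if x = i+1 then (i:ℤ)+2 else if x = i+2 then (i:ℤ)+1 else
    if x = -(i+1) then -((i:ℤ)+2) else if x = -(i+2) then -((i:ℤ)+1) else x := by
  simp only [sB, Equiv.swap_apply_def, Equiv.Perm.mul_apply]
  split_ifs <;> omega

lemma sB_odd (i : ℕ) (x : ℤ) : sB i (-x) = - sB i x := by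
  rcases i with _ | i
  · simp only [sB_zero_apply]; split_ifs <;> omega
  · simp only [sB_succ_apply]; split_ifs <;> omega

lemma sB_invol (i : ℕ) (x : ℤ) : sB i (sB i x) = x := by
  rcases i with _ | i
  · simp [sB]
  · have h1 := sB_succ_apply i x
    have h2 := sB_succ_apply i (sB (i+1) x)
    generalize sB (i+1) (sB (i+1) x) = z at *
    generalize sB (i+1) x = y at *
    split_ifs at h1 <;> split_ifs at h2 <;> omega

lemma sB_mul_self (i : ℕ) : sB i * sB i = 1 := by
  ext x; simp [sB_invol]

lemma sB_comm_aux (i j : ℕ) (h : i + 1 < j) : sB i * sB j = sB j * sB i := by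
  ext x
  simp only [Equiv.Perm.mul_apply]
  obtain ⟨j, rfl⟩ : ∃ k, j = k + 1 := ⟨j - 1, by omega⟩
  have h1 := sB_succ_apply j x
  have h2 := sB_succ_apply j (sB i x)
  generalize sB (j+1) (sB i x) = u at *
  generalize sB (j+1) x = v at *
  rcases i with _ | i
  · have h3 := sB_zero_apply x
    have h4 := sB_zero_apply v
    generalize sB 0 x = y at *
    generalize sB 0 v = z at *
    split_ifs at h1 <;> split_ifs at h3 <;> split_ifs at h4 <;> split_ifs at h2 <;> omega
  · have h3 := sB_succ_apply i x
    have h4 := sB_succ_apply i v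
    generalize sB (i+1) x = y at *
    generalize sB (i+1) v = z at *
    split_ifs at h1 <;> split_ifs at h3 <;> omega

lemma sB_comm (i j : ℕ) (h : i + 1 < j ∨ j + 1 < i) : sB i * sB j = sB j * sB i := by
  rcases h with h | h
  · exact sB_comm_aux i j h
  · exact (sB_comm_aux j i h).symm

lemma prodB_nil : prodB [] = 1 := rfl
lemma prodB_cons (i : ℕ) (b : List ℕ) : prodB (i :: b) = sB i * prodB b := by simp [prodB]
lemma prodB_append (a b : List ℕ) : prodB (a ++ b) = prodB a * prodB b := by simp [prodB]

lemma prodB_odd (b : List ℕ) (x : ℤ) : prodB b (-x) = - prodB b x := by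
  induction b generalizing x with
  | nil => simp [prodB]
  | cons i b ih => simp [prodB_cons, ih, sB_odd]

lemma prodB_comm (i : ℕ) (b : List ℕ) (h : ∀ j ∈ b, i + 1 < j ∨ j + 1 < i) :
    sB i * prodB b = prodB b * sB i := by
  induction b with
  | nil => simp [prodB]
  | cons j b ih =>
    rw [prodB_cons, ← mul_assoc, sB_comm i j (h j (by simp)), mul_assoc,
      ih (fun k hk => h k (by simp [hk])), mul_assoc]

/-- `x` preserves the set of integers `> i`. -/
def Pres (i : ℕ) (x : Equiv.Perm ℤ) : Prop := ∀ y : ℤ, (i : ℤ) < x y ↔ (i : ℤ) < y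

lemma Pres.mul {i : ℕ} {x y : Equiv.Perm ℤ} (hx : Pres i x) (hy : Pres i y) : Pres i (x * y) := by
  intro z; rw [Equiv.Perm.mul_apply, hx, hy]

lemma Pres.inv {i : ℕ} {x : Equiv.Perm ℤ} (hx : Pres i x) : Pres i x⁻¹ := by
  intro z; rw [← hx]; simp

lemma pres_one (i : ℕ) : Pres i 1 := by intro z; simp

lemma pres_sB {i j : ℕ} (h : j ≠ i) : Pres i (sB j) := by
  intro z
  rcases j with _ | j
  · simp only [sB_zero_apply]; split_ifs <;> omega
  · simp only [sB_succ_apply]; split_ifs <;> omega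

lemma sB_top (i : ℕ) : ¬ ((i : ℤ) < sB i (i + 1)) := by
  rcases i with _ | i
  · simp [sB_zero_apply]
  · simp only [sB_succ_apply]; push_cast; split_ifs <;> omega

lemma not_pres_sB (i : ℕ) : ¬ Pres i (sB i) := by
  intro h
  exact sB_top i ((h _).2 (by omega))

lemma pres_prodB {i : ℕ} {b : List ℕ} (h : i ∉ b) : Pres i (prodB b) := by
  induction b with
  | nil => exact pres_one i
  | cons j b ih =>
    simp only [List.mem_cons, not_or] at h
    rw [prodB_cons]
    exact (pres_sB (Ne.symm h.1)).mul (ih h.2)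

lemma mem_iff_of_nodup {i : ℕ} {b : List ℕ} (hb : b.Nodup) : i ∈ b ↔ ¬ Pres i (prodB b) := by
  constructor
  · intro hi hp
    obtain ⟨p, q, rfl⟩ := List.append_of_mem hi
    have h1 : i ∉ p := by grind
    have h2 : i ∉ q := by grind
    rw [prodB_append, prodB_cons] at hp
    have := ((pres_prodB h1).inv.mul hp).mul (pres_prodB h2).inv
    simp at this
    exact not_pres_sB i this
  · intro h
    by_contra h'
    exact h (pres_prodB h')

lemma nodup_subset {b b' : List ℕ} (hb : b.Nodup) (h : prodB b' = prodB b) : b ⊆ b' := by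
  intro i hi
  by_contra h'
  exact (mem_iff_of_nodup hb).1 hi (h ▸ pres_prodB h')

lemma reduced_of_nodup {n : ℕ} {b : List ℕ} (hw : IsWordBD n b) (hb : b.Nodup) :
    ReducedB n b (prodB b) :=
  ⟨hw, rfl, fun _ _ h => (List.subperm_of_subset hb (nodup_subset hb h)).length_le⟩

lemma perm_of_reduced {n : ℕ} {b b' : List ℕ} (hw : IsWordBD n b) (hb : b.Nodup)
    (hr : ReducedB n b' (prodB b)) : b.Perm b' :=
  (List.subperm_of_subset hb (nodup_subset hb hr.2.1)).perm_of_length_le (hr.2.2 b hw rfl)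

/-- If `b = b1 ++ i :: b2` and `i :: a` are nodup words of the same element then `i`
commutes past `b1`. -/
lemma commute_front {i : ℕ} {a b1 b2 : List ℕ} (ha : (i :: a).Nodup)
    (hb : (b1 ++ i :: b2).Nodup) (h : prodB (i :: a) = prodB (b1 ++ i :: b2)) :
    ∀ j ∈ b1, i + 1 < j ∨ j + 1 < i := by
  have h1 : i ∉ b1 := by grind
  have h2 : i ∉ b2 := by grind
  have h3 : i ∉ a := by grind
  have hb1 : b1.Nodup := by grind
  have P1 := pres_prodB h1
  -- b1 preserves `s_i U_i`
  have key : ∀ z : ℤ, (i:ℤ) < sB i (prodB b1 z) ↔ (i:ℤ) < sB i z := by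
    have e : sB i * prodB b1 * sB i = prodB a * (prodB b2)⁻¹ := by
      rw [prodB_cons, prodB_append, prodB_cons] at h
      have : prodB a = sB i * (sB i * prodB a) := by rw [← mul_assoc, sB_mul_self, one_mul]
      rw [this, h]; group
    have hp : Pres i (sB i * prodB b1 * sB i) := e ▸ (pres_prodB h3).mul (pres_prodB h2).inv
    intro z
    have := hp (sB i z)
    simpa [sB_invol] using this
  intro j hj
  by_contra hc
  have hne : j ≠ i := fun h => h1 (h ▸ hj)
  have : j = i + 1 ∨ j + 1 = i := by omega
  apply (mem_iff_of_nodup hb1).1 hj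
  intro z
  have k1 := key z
  have k2 := P1 z
  generalize prodB b1 z = t at *
  rcases i with _ | i
  · simp only [sB_zero_apply] at k1
    split_ifs at k1 <;> omega
  · simp only [sB_succ_apply] at k1
    split_ifs at k1 <;> omega

lemma filter_prod (T : ℕ → Bool) (a b : List ℕ) (ha : a.Nodup) (hb : b.Nodup)
    (h : prodB a = prodB b) : prodB (a.filter T) = prodB (b.filter T) := by
  induction a generalizing b with
  | nil =>
    have := nodup_subset hb h
    have : b = [] := List.subset_nil.1 this
    subst this; rfl
  | cons i a ih =>
    have hi : i ∈ b := nodup_subset ha h.symm (by simp)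
    obtain ⟨b1, b2, rfl⟩ := List.append_of_mem hi
    have hc := commute_front ha hb h
    have e : prodB a = prodB (b1 ++ b2) := by
      rw [prodB_cons, prodB_append, prodB_cons, ← mul_assoc, ← prodB_comm i b1 hc, mul_assoc] at h
      rw [prodB_append]
      exact mul_left_cancel h
    have := ih (b1 ++ b2) (by grind) (by grind) e
    have hc' : ∀ j ∈ b1.filter T, i + 1 < j ∨ j + 1 < i :=
      fun j hj => hc j (List.mem_of_mem_filter hj)
    rw [List.filter_append, prodB_append] at this
    rw [List.filter_append, List.filter_cons, List.filter_cons]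
    split_ifs
    · rw [prodB_cons, prodB_append, prodB_cons, this, ← mul_assoc, prodB_comm _ _ hc', mul_assoc]
    · rw [prodB_append, this]

/-- The reflection exchanging `c` and `d` (and `-c`, `-d`). -/
def rflB (c d : ℤ) : Equiv.Perm ℤ :=
  if d = -c then Equiv.swap c d else Equiv.swap c d * Equiv.swap (-c) (-d)

lemma sB_ne_zero (k : ℕ) {c : ℤ} (h : c ≠ 0) : sB k c ≠ 0 := by
  intro h'
  have := sB_odd k c
  have e : sB k (-c) = sB k c := by omega
  have := (sB k).injective e
  omega

lemma rflB_conj (k : ℕ) (c d : ℤ) : rflB c d * sB k = sB k * rflB (sB k c) (sB k d) := by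
  have hiff : d = -c ↔ sB k d = - sB k c := by
    rw [← sB_odd]; exact (sB k).injective.eq_iff.symm
  unfold rflB
  simp only [← hiff]
  split_ifs
  · rw [Equiv.mul_swap_eq_swap_mul, sB_invol, sB_invol]
  · have key : ∀ x y, sB k * Equiv.swap (sB k x) (sB k y) = Equiv.swap x y * sB k := by
      intro x y
      rw [Equiv.mul_swap_eq_swap_mul, sB_invol, sB_invol]
    rw [← mul_assoc, key, mul_assoc, mul_assoc, ← sB_odd, ← sB_odd, key]

lemma rflB_flip (k : ℕ) (c d : ℤ) (hc : c ≠ 0) (hd : d ≠ 0) (h : c < d) (h' : sB k d < sB k c) :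
    rflB c d = sB k := by
  rcases k with _ | k
  · have : c = -1 ∧ d = 1 := by
      simp only [sB_zero_apply] at h'
      split_ifs at h' <;> omega
    obtain ⟨rfl, rfl⟩ := this
    simp [rflB, sB, Equiv.swap_comm]
  · have : (c = k + 1 ∧ d = k + 2) ∨ (c = -(k+2) ∧ d = -(k+1)) := by
      simp only [sB_succ_apply] at h'
      split_ifs at h' <;> omega
    rcases this with ⟨rfl, rfl⟩ | ⟨rfl, rfl⟩
    · rw [rflB, if_neg (by omega)]; rfl
    · rw [rflB, if_neg (by omega)]
      simp only [neg_neg, sB]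
      rw [Equiv.swap_comm, Equiv.swap_comm ((k:ℤ)+2)]
      ext x
      simp only [Equiv.Perm.mul_apply, Equiv.swap_apply_def]
      split_ifs <;> omega

lemma exchange (q : List ℕ) (c d : ℤ) (hc : c ≠ 0) (hd : d ≠ 0) (h : c < d)
    (h' : (prodB q)⁻¹ d < (prodB q)⁻¹ c) :
    ∃ q' : List ℕ, q'.length + 1 = q.length ∧ q' ⊆ q ∧ rflB c d * prodB q = prodB q' := by
  induction q generalizing c d with
  | nil => simp [prodB] at h'; omega
  | cons k q ih =>
    have hs : ∀ x, (prodB (k :: q))⁻¹ x = (prodB q)⁻¹ (sB k x) := by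
      intro x
      rw [prodB_cons, mul_inv_rev, Equiv.Perm.mul_apply]
      congr 1
      rw [Equiv.Perm.inv_eq_iff_eq, sB_invol]
    rw [hs, hs] at h'
    rcases lt_trichotomy (sB k c) (sB k d) with hlt | heq | hgt
    · obtain ⟨q', h1, h2, h3⟩ := ih _ _ (sB_ne_zero k hc) (sB_ne_zero k hd) hlt h'
      refine ⟨k :: q', by simp [h1], ?_, ?_⟩
      · intro x hx
        simp only [List.mem_cons] at hx ⊢
        rcases hx with hx | hx
        · exact Or.inl hx
        · exact Or.inr (h2 hx)
      · rw [prodB_cons, prodB_cons, ← mul_assoc, rflB_conj, mul_assoc, h3]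
    · exact absurd ((sB k).injective heq) h.ne
    · refine ⟨q, by simp, by simp, ?_⟩
      rw [rflB_flip k c d hc hd h hgt, prodB_cons, ← mul_assoc, sB_mul_self, one_mul]

lemma not_pres_of_reduced {n : ℕ} {b : List ℕ} {x : Equiv.Perm ℤ} (hr : ReducedB n b x) {j : ℕ}
    (hj : j ∈ b) : ¬ Pres j x := by
  intro hp
  obtain ⟨p, q, rfl, hjp⟩ := List.eq_append_cons_of_mem hj
  obtain ⟨hw, rfl, hmin⟩ := hr
  have hp2 : Pres j (prodB (j :: q)) := by
    have := (pres_prodB hjp).inv.mul hp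
    rwa [prodB_append, inv_mul_cancel_left] at this
  have hs : ∀ x, (prodB (j :: q))⁻¹ x = (prodB q)⁻¹ (sB j x) := by
    intro x
    rw [prodB_cons, mul_inv_rev, Equiv.Perm.mul_apply]
    congr 1
    rw [Equiv.Perm.inv_eq_iff_eq, sB_invol]
  have h1 := hp2.inv (sB j (j + 1))
  have h2 := hp2.inv (j + 1)
  rw [hs, sB_invol] at h1
  rw [hs] at h2
  have ht := sB_top j
  have hlt : sB j (j + 1) < j + 1 := by omega
  have hne : sB j (j + 1) ≠ 0 := sB_ne_zero j (by omega)
  have hex : (prodB q)⁻¹ (j + 1) < (prodB q)⁻¹ (sB j (j + 1)) := by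
    have : (j : ℤ) < j + 1 := by omega
    have a1 : ¬ ((j : ℤ) < (prodB q)⁻¹ (j + 1)) := fun h => ht (h1.1 h)
    have a2 := h2.2 this
    omega
  obtain ⟨q', e1, e2, e3⟩ := exchange q _ _ hne (by omega) hlt hex
  rw [rflB_flip j _ _ hne (by omega) hlt (by rw [sB_invol]; exact hlt)] at e3
  have := hmin (p ++ q') (by
    intro i hi
    apply hw
    simp only [List.mem_append, List.mem_cons] at hi ⊢
    rcases hi with hi | hi
    · exact Or.inl hi
    · exact Or.inr (Or.inr (e2 hi))) (by rw [prodB_append, prodB_append, prodB_cons, e3])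
  simp at this
  omega

lemma reduced_append_left {n : ℕ} {a b : List ℕ} {x : Equiv.Perm ℤ} (h : ReducedB n (a ++ b) x) :
    ReducedB n a (prodB a) := by
  obtain ⟨h1, h2, h3⟩ := h
  refine ⟨fun i hi => h1 i (by simp [hi]), rfl, fun w' hw' he => ?_⟩
  have := h3 (w' ++ b) (by
    intro i hi
    rcases List.mem_append.1 hi with hi | hi
    · exact hw' i hi
    · exact h1 i (by simp [hi])) (by rw [prodB_append, he, ← prodB_append, h2])
  simpa using this

lemma nodup_of_boolean {n : ℕ} {w : Equiv.Perm ℤ} (h : BooleanB n w) :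
    ∃ b : List ℕ, IsWordBD n b ∧ b.Nodup ∧ prodB b = w := by
  classical
  obtain ⟨r, e, he⟩ := h
  obtain ⟨-, b, -, hb, -⟩ := (e.symm ∅).2
  refine ⟨b, hb.1, ?_, hb.2.1⟩
  -- prefixes form a chain
  have hpre : ∀ k, ReducedB n (b.take k) (prodB (b.take k)) := by
    intro k
    apply reduced_append_left (b := b.drop k) (x := w)
    rwa [List.take_append_drop]
  let u : ℕ → {v : Equiv.Perm ℤ // bruhatB n v w} := fun k =>
    ⟨prodB (b.take k), b.take k, b, hpre k, hb, List.take_sublist k b⟩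
  have hchain : ∀ k, k ≤ b.length → k ≤ (e (u k)).card := by
    intro k
    induction k with
    | zero => simp
    | succ k ih =>
      intro hk
      have hsub : e (u k) ⊆ e (u (k+1)) := (he _ _).1
        ⟨b.take k, b.take (k+1), hpre k, hpre (k+1), List.take_sublist_take_left (by omega)⟩
      have hne : e (u k) ≠ e (u (k+1)) := by
        intro heq
        have h1 : prodB (b.take k) = prodB (b.take (k+1)) := congrArg Subtype.val (e.injective heq)
        have h2 := (hpre (k+1)).2.2 _ (hpre k).1 h1
        simp at h2
        omega
      have := Finset.card_lt_card (Finset.ssubset_iff_subset_ne.2 ⟨hsub, hne⟩)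
      have := ih (by omega)
      omega
  have hlen : b.length ≤ r := by
    have := hchain b.length le_rfl
    have h2 := Finset.card_le_univ (e (u b.length))
    simp at h2
    omega
  -- atoms
  have hnil : ReducedB n [] 1 := ⟨by intro i hi; simp at hi, rfl, by simp⟩
  let one : {v : Equiv.Perm ℤ // bruhatB n v w} := ⟨1, [], b, hnil, hb, by simp⟩
  have hone : e one = ∅ := by
    have : e one ⊆ e (e.symm ∅) := by
      apply (he _ _).1
      obtain ⟨a, -, ha, -, -⟩ := (e.symm ∅).2
      exact ⟨[], a, hnil, ha, by simp⟩
    simpa using this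
  have hat : ∀ i : Fin r, ∃ j ∈ b, ((e.symm {i}).1 : Equiv.Perm ℤ) = sB j := by
    intro i
    obtain ⟨a, b', ha, hb', hab⟩ := (e.symm {i}).2
    have hane : a ≠ [] := by
      rintro rfl
      have h1 : (e.symm {i}) = one := Subtype.ext ha.2.1.symm
      have h2 : e (e.symm {i}) = ∅ := by rw [h1, hone]
      simp at h2
    obtain ⟨j, hj⟩ := List.exists_mem_of_ne_nil a hane
    have hjb' : j ∈ b' := hab.subset hj
    have hred : ReducedB n [j] (sB j) := by
      have := reduced_of_nodup (n := n) (b := [j]) (by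
        intro k hk; simp at hk; subst hk; exact hb'.1 _ hjb') (by simp)
      simpa [prodB] using this
    let at' : {v : Equiv.Perm ℤ // bruhatB n v w} :=
      ⟨sB j, [j], b', hred, hb', by simpa using hjb'⟩
    have hsub : e at' ⊆ {i} := by
      have : e at' ⊆ e (e.symm {i}) := (he _ _).1 ⟨[j], a, hred, ha, by simpa using hj⟩
      simpa using this
    have hne : e at' ≠ ∅ := by
      rw [← hone]
      intro h
      have : sB j = 1 := congrArg Subtype.val (e.injective h)
      exact not_pres_sB j (this ▸ pres_one j)
    have heq : e at' = {i} := by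
      rcases Finset.subset_singleton_iff.1 hsub with h | h
      · exact absurd h hne
      · exact h
    refine ⟨j, ?_, ?_⟩
    · by_contra hjb
      apply not_pres_of_reduced hb' hjb'
      rw [← hb.2.1]
      exact pres_prodB hjb
    · rw [← heq]; simp [at']
  choose f hf1 hf2 using hat
  have hinj : Function.Injective f := by
    intro i i' hii
    have : e.symm {i} = e.symm {i'} := Subtype.ext (by rw [hf2, hf2, hii])
    simpa using this
  have hcard : r ≤ b.toFinset.card := by
    have := Finset.card_le_card_of_injOn (s := Finset.univ) (t := b.toFinset) f
      (by intro i _; simpa using hf1 i) hinj.injOn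
    simpa using this
  have h3 : b.toFinset.card = b.length := le_antisymm (List.toFinset_card_le b) (by omega)
  rw [List.card_toFinset] at h3
  exact List.dedup_eq_self.1 ((List.dedup_sublist b).eq_of_length h3)

lemma sublist_eq_filter {a b : List ℕ} (h : a.Sublist b) (hb : b.Nodup) :
    a = b.filter (fun i => decide (i ∈ a)) := by
  induction h with
  | slnil => rfl
  | cons x h ih =>
    rw [List.nodup_cons] at hb
    rw [List.filter_cons_of_neg (by simpa using fun hx => hb.1 (h.subset hx)), ← ih hb.2]
  | cons_cons x h ih =>
    rw [List.nodup_cons] at hb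
    rw [List.filter_cons_of_pos (by simp)]
    congr 1
    conv_lhs => rw [ih hb.2]
    apply List.filter_congr
    intro y hy
    have : y ≠ x := fun e => hb.1 (e ▸ hy)
    simp [this]

open Classical in
lemma eq_filter_of_le {n : ℕ} {b : List ℕ} (hw : IsWordBD n b) (hb : b.Nodup) {v : Equiv.Perm ℤ}
    (hv : bruhatB n v (prodB b)) : v = prodB (b.filter (fun i => decide (¬ Pres i v))) := by
  obtain ⟨a, b', ha, hb', hab⟩ := hv
  have hn : b'.Nodup := (perm_of_reduced hw hb hb').nodup_iff.1 hb
  have hna : a.Nodup := hn.sublist hab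
  obtain ⟨-, rfl, -⟩ := ha
  have h1 := sublist_eq_filter hab hn
  rw [filter_prod _ b b' hb hn hb'.2.1.symm]
  have : b'.filter (fun i => decide (¬ Pres i (prodB a))) = a := by
    conv_rhs => rw [h1]
    apply List.filter_congr
    intro i _
    simp only [mem_iff_of_nodup hna]
  rw [this]

lemma boolean_of_nodup {n : ℕ} {b : List ℕ} (hw : IsWordBD n b) (hb : b.Nodup) :
    BooleanB n (prodB b) := by
  classical
  have hfw : ∀ T : ℕ → Bool, IsWordBD n (b.filter T) :=
    fun T i hi => hw i (List.mem_of_mem_filter hi)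
  have hfn : ∀ T : ℕ → Bool, (b.filter T).Nodup := fun T => hb.filter T
  let E : {v : Equiv.Perm ℤ // bruhatB n v (prodB b)} → Finset (Fin b.length) :=
    fun v => Finset.univ.filter (fun k => ¬ Pres (b.get k) v.1)
  have hord : ∀ x y : {v : Equiv.Perm ℤ // bruhatB n v (prodB b)},
      E x ⊆ E y → bruhatB n x.1 y.1 := by
    intro x y hxy
    have hx := eq_filter_of_le hw hb x.2
    have hy := eq_filter_of_le hw hb y.2
    have hrx := reduced_of_nodup (hfw (fun i => decide (¬ Pres i x.1))) (hfn _)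
    have hry := reduced_of_nodup (hfw (fun i => decide (¬ Pres i y.1))) (hfn _)
    rw [← hx] at hrx
    rw [← hy] at hry
    refine ⟨_, _, hrx, hry, ?_⟩
    have : b.filter (fun i => decide (¬ Pres i x.1)) =
        (b.filter (fun i => decide (¬ Pres i y.1))).filter (fun i => decide (¬ Pres i x.1)) := by
      rw [List.filter_filter]
      apply List.filter_congr
      intro i hi
      obtain ⟨k, rfl⟩ := List.get_of_mem hi
      have := @hxy k
      simp only [E, Finset.mem_filter, Finset.mem_univ, true_and] at this
      simpa using this
    rw [this]
    exact List.filter_sublist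
  have hbij : Function.Bijective E := by
    constructor
    · intro x y hxy
      apply Subtype.ext
      rw [eq_filter_of_le hw hb x.2, eq_filter_of_le hw hb y.2]
      congr 1
      apply List.filter_congr
      intro i hi
      obtain ⟨k, rfl⟩ := List.get_of_mem hi
      have := Finset.ext_iff.1 hxy k
      simp only [E, Finset.mem_filter, Finset.mem_univ, true_and] at this
      simp only [this]
    · intro X
      let T : ℕ → Bool := fun i => decide (∃ k ∈ X, b.get k = i)
      refine ⟨⟨prodB (b.filter T), b.filter T, b, reduced_of_nodup (hfw _) (hfn _),
        reduced_of_nodup hw hb, List.filter_sublist⟩, ?_⟩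
      ext k
      simp only [E, Finset.mem_filter, Finset.mem_univ, true_and]
      rw [← mem_iff_of_nodup (hfn T), List.mem_filter]
      simp only [T, decide_eq_true_eq]
      constructor
      · rintro ⟨-, k', hk', h⟩
        rwa [← (List.nodup_iff_injective_get.1 hb) h]
      · intro h
        exact ⟨List.get_mem _ _, k, h, rfl⟩
  refine ⟨b.length, Equiv.ofBijective E hbij, fun x y => ⟨?_, fun h => hord x y h⟩⟩
  rintro ⟨a, b', ha, hb', hab⟩
  have hy := eq_filter_of_le hw hb y.2
  have hb'n : b'.Nodup :=
    (perm_of_reduced (b' := b') (hfw _) (hfn _) (hy ▸ hb')).nodup_iff.1 (hfn _)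
  intro k hk
  simp only [Equiv.ofBijective_apply, E, Finset.mem_filter, Finset.mem_univ, true_and] at hk ⊢
  rw [← ha.2.1, ← mem_iff_of_nodup (hb'n.sublist hab)] at hk
  rw [← hb'.2.1, ← mem_iff_of_nodup hb'n]
  exact hab.subset hk

lemma mk2 {n : ℕ} {w : Equiv.Perm ℤ} (p q : ℤ) (a b : ℤ) (h1 : 1 ≤ a) (h2 : a < b) (h3 : b ≤ n)
    (sa : 0 < w a ↔ 0 < p) (sb : 0 < w b ↔ 0 < q)
    (o1 : |w a| < |w b| ↔ |p| < |q|) (o2 : |w b| < |w a| ↔ |q| < |p|) :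
    containsPat n w [p, q] := by
  refine ⟨fun j => (![a, b] : Fin 2 → ℤ) j, ?_, ?_, ?_, ?_⟩
  · rw [Fin.strictMono_iff_lt_succ (n := 1)]
    simpa [Fin.forall_fin_succ] using h2
  · change ∀ j : Fin 2, _
    simp [Fin.forall_fin_succ]; omega
  · change ∀ j : Fin 2, _
    simp [Fin.forall_fin_succ]; exact ⟨sa, sb⟩
  · change ∀ j j' : Fin 2, _
    simp [Fin.forall_fin_succ]; exact ⟨o1, o2⟩

lemma mk3 {n : ℕ} {w : Equiv.Perm ℤ} (p q r : ℤ) (a b c : ℤ) (h1 : 1 ≤ a) (h2 : a < b)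
    (h2' : b < c) (h3 : c ≤ n)
    (sa : 0 < w a ↔ 0 < p) (sb : 0 < w b ↔ 0 < q) (sc : 0 < w c ↔ 0 < r)
    (o1 : |w a| < |w b| ↔ |p| < |q|) (o2 : |w b| < |w a| ↔ |q| < |p|)
    (o3 : |w a| < |w c| ↔ |p| < |r|) (o4 : |w c| < |w a| ↔ |r| < |p|)
    (o5 : |w b| < |w c| ↔ |q| < |r|) (o6 : |w c| < |w b| ↔ |r| < |q|) :
    containsPat n w [p, q, r] := by
  refine ⟨fun j => (![a, b, c] : Fin 3 → ℤ) j, ?_, ?_, ?_, ?_⟩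
  · rw [Fin.strictMono_iff_lt_succ (n := 2)]
    simpa [Fin.forall_fin_succ] using ⟨h2, h2'⟩
  · change ∀ j : Fin 3, _
    simp [Fin.forall_fin_succ]; omega
  · change ∀ j : Fin 3, _
    simp [Fin.forall_fin_succ]; exact ⟨sa, sb, sc⟩
  · change ∀ j j' : Fin 3, _
    simp [Fin.forall_fin_succ]; exact ⟨⟨o1, o3⟩, ⟨o2, o5⟩, o4, o6⟩

lemma mk4 {n : ℕ} {w : Equiv.Perm ℤ} (p q r s : ℤ) (a b c d : ℤ) (h1 : 1 ≤ a) (h2 : a < b)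
    (h2' : b < c) (h2'' : c < d) (h3 : d ≤ n)
    (sa : 0 < w a ↔ 0 < p) (sb : 0 < w b ↔ 0 < q) (sc : 0 < w c ↔ 0 < r) (sd : 0 < w d ↔ 0 < s)
    (o1 : |w a| < |w b| ↔ |p| < |q|) (o2 : |w b| < |w a| ↔ |q| < |p|)
    (o3 : |w a| < |w c| ↔ |p| < |r|) (o4 : |w c| < |w a| ↔ |r| < |p|)
    (o5 : |w b| < |w c| ↔ |q| < |r|) (o6 : |w c| < |w b| ↔ |r| < |q|)
    (o7 : |w a| < |w d| ↔ |p| < |s|) (o8 : |w d| < |w a| ↔ |s| < |p|)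
    (o9 : |w b| < |w d| ↔ |q| < |s|) (o10 : |w d| < |w b| ↔ |s| < |q|)
    (o11 : |w c| < |w d| ↔ |r| < |s|) (o12 : |w d| < |w c| ↔ |s| < |r|) :
    containsPat n w [p, q, r, s] := by
  refine ⟨fun j => (![a, b, c, d] : Fin 4 → ℤ) j, ?_, ?_, ?_, ?_⟩
  · rw [Fin.strictMono_iff_lt_succ (n := 3)]
    simpa [Fin.forall_fin_succ] using ⟨h2, h2', h2''⟩
  · change ∀ j : Fin 4, _
    simp [Fin.forall_fin_succ]; omega
  · change ∀ j : Fin 4, _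
    simp [Fin.forall_fin_succ]; exact ⟨sa, sb, sc, sd⟩
  · change ∀ j j' : Fin 4, _
    simp [Fin.forall_fin_succ]
    exact ⟨⟨o1, o3, o7⟩, ⟨o2, o5, o9⟩, ⟨o4, o6, o11⟩, o8, o10, o12⟩

/-- The ten patterns. -/
def pats : List (List ℤ) :=
  [[-1,-2], [-2,-1], [3,2,1], [3,4,1,2], [3,2,-1], [3,4,-1,2], [-3,2,1], [-3,4,1,2], [1,-2],
    [3,-2,1]]

lemma sp_zero {n : ℕ} {w : Equiv.Perm ℤ} (hw : IsSignedPerm n w) : w 0 = 0 := by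
  have := hw.1 0
  simp at this
  omega

lemma sp_abs_inj {n : ℕ} {w : Equiv.Perm ℤ} (hw : IsSignedPerm n w) {x y : ℤ} (hx : 1 ≤ x)
    (hy : 1 ≤ y) (h : |w x| = |w y|) : x = y := by
  rcases abs_eq_abs.1 h with h | h
  · exact w.injective h
  · rw [← hw.1] at h
    have := w.injective h
    omega

lemma sp_range {n : ℕ} {w : Equiv.Perm ℤ} (hw : IsSignedPerm n w) {x : ℤ} (hx : 1 ≤ x)
    (hx' : x ≤ n) : 1 ≤ |w x| ∧ |w x| ≤ n := by
  constructor
  · have : w x ≠ 0 := by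
      intro h
      have := w.injective (h.trans (sp_zero hw).symm)
      omega
    exact Int.one_le_abs this
  · by_contra h
    push Not at h
    have := w.injective (hw.2 _ h)
    rw [this, abs_of_pos (by omega)] at h
    omega

lemma sp_surj {n : ℕ} {w : Equiv.Perm ℤ} (hw : IsSignedPerm n w) {y : ℤ} (hy : 1 ≤ y)
    (hy' : y ≤ n) : ∃ x : ℤ, 1 ≤ x ∧ x ≤ n ∧ (w x = y ∨ w x = -y) := by
  obtain ⟨x, rfl⟩ := w.surjective y
  have hx0 : x ≠ 0 := by
    rintro rfl
    rw [sp_zero hw] at hy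
    omega
  have hxn : |x| ≤ n := by
    by_contra h
    push Not at h
    rw [hw.2 x h] at hy hy'
    rw [abs_of_pos (by omega)] at h
    omega
  refine ⟨|x|, Int.one_le_abs hx0, hxn, ?_⟩
  rcases abs_choice x with h | h <;> rw [h]
  · exact Or.inl rfl
  · exact Or.inr (hw.1 x)

lemma av_neg {n : ℕ} {w : Equiv.Perm ℤ} (hw : IsSignedPerm n w)
    (h : ∀ p ∈ pats, ¬ containsPat n w p) (a b : ℤ) (h1 : 1 ≤ a) (h2 : a < b) (h3 : b ≤ n)
    (ha : w a < 0) (hb : w b < 0) : False := by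
  rcases lt_trichotomy |w a| |w b| with hlt | heq | hgt
  · refine h [-1,-2] (by simp [pats]) (mk2 _ _ a b h1 h2 h3 ?_ ?_ ?_ ?_) <;> norm_num <;> omega
  · have := sp_abs_inj hw h1 (by omega) heq
    omega
  · refine h [-2,-1] (by simp [pats]) (mk2 _ _ a b h1 h2 h3 ?_ ?_ ?_ ?_) <;> norm_num <;> omega

lemma av_pn {n : ℕ} {w : Equiv.Perm ℤ}
    (h : ∀ p ∈ pats, ¬ containsPat n w p) (a b : ℤ) (h1 : 1 ≤ a) (h2 : a < b) (h3 : b ≤ n)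
    (ha : 0 < w a) (hb : w b < 0) (hab : |w a| < |w b|) : False := by
  refine h [1,-2] (by simp [pats]) (mk2 _ _ a b h1 h2 h3 ?_ ?_ ?_ ?_) <;> norm_num <;> omega

lemma sp_sign {n : ℕ} {w : Equiv.Perm ℤ} (hw : IsSignedPerm n w) {x : ℤ} (hx : 1 ≤ x)
    (hx' : x ≤ n) : 0 < w x ∨ w x < 0 := by
  have := (sp_range hw hx hx').1
  rcases lt_trichotomy (w x) 0 with h | h | h
  · exact Or.inr h
  · rw [h] at this; simp at this
  · exact Or.inl h

lemma av_3 {n : ℕ} {w : Equiv.Perm ℤ} (hw : IsSignedPerm n w)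
    (h : ∀ p ∈ pats, ¬ containsPat n w p) (a b c : ℤ) (h1 : 1 ≤ a) (h2 : a < b) (h2' : b < c)
    (h3 : c ≤ n) (ha : 0 < w a) (hab : |w b| < |w a|) (hbc : |w c| < |w b|) : False := by
  rcases sp_sign hw (x := b) (by omega) (by omega) with hb | hb <;>
    rcases sp_sign hw (x := c) (by omega) (by omega) with hc | hc
  · refine h [3,2,1] (by simp [pats]) (mk3 _ _ _ a b c h1 h2 h2' h3 ?_ ?_ ?_ ?_ ?_ ?_ ?_ ?_ ?_)
      <;> norm_num <;> omega
  · refine h [3,2,-1] (by simp [pats]) (mk3 _ _ _ a b c h1 h2 h2' h3 ?_ ?_ ?_ ?_ ?_ ?_ ?_ ?_ ?_)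
      <;> norm_num <;> omega
  · refine h [3,-2,1] (by simp [pats]) (mk3 _ _ _ a b c h1 h2 h2' h3 ?_ ?_ ?_ ?_ ?_ ?_ ?_ ?_ ?_)
      <;> norm_num <;> omega
  · exact av_neg hw h b c (by omega) h2' h3 hb hc

lemma av_3' {n : ℕ} {w : Equiv.Perm ℤ}
    (h : ∀ p ∈ pats, ¬ containsPat n w p) (a b c : ℤ) (h1 : 1 ≤ a) (h2 : a < b) (h2' : b < c)
    (h3 : c ≤ n) (ha : w a < 0) (hb : 0 < w b) (hc : 0 < w c)
    (hab : |w b| < |w a|) (hbc : |w c| < |w b|) : False := by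
  refine h [-3,2,1] (by simp [pats]) (mk3 _ _ _ a b c h1 h2 h2' h3 ?_ ?_ ?_ ?_ ?_ ?_ ?_ ?_ ?_)
      <;> norm_num <;> omega

lemma av_4 {n : ℕ} {w : Equiv.Perm ℤ} (hw : IsSignedPerm n w)
    (h : ∀ p ∈ pats, ¬ containsPat n w p) (a b c d : ℤ) (h1 : 1 ≤ a) (h2 : a < b) (h2' : b < c)
    (h2'' : c < d) (h3 : d ≤ n) (hb : 0 < w b) (hd : 0 < w d)
    (hcd : |w c| < |w d|) (hda : |w d| < |w a|) (hab : |w a| < |w b|) : False := by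
  rcases sp_sign hw (x := a) (by omega) (by omega) with ha | ha <;>
    rcases sp_sign hw (x := c) (by omega) (by omega) with hc | hc
  · refine h [3,4,1,2] (by simp [pats]) (mk4 _ _ _ _ a b c d h1 h2 h2' h2'' h3
      ?_ ?_ ?_ ?_ ?_ ?_ ?_ ?_ ?_ ?_ ?_ ?_ ?_ ?_ ?_ ?_) <;> norm_num <;> omega
  · refine h [3,4,-1,2] (by simp [pats]) (mk4 _ _ _ _ a b c d h1 h2 h2' h2'' h3
      ?_ ?_ ?_ ?_ ?_ ?_ ?_ ?_ ?_ ?_ ?_ ?_ ?_ ?_ ?_ ?_) <;> norm_num <;> omega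
  · refine h [-3,4,1,2] (by simp [pats]) (mk4 _ _ _ _ a b c d h1 h2 h2' h2'' h3
      ?_ ?_ ?_ ?_ ?_ ?_ ?_ ?_ ?_ ?_ ?_ ?_ ?_ ?_ ?_ ?_) <;> norm_num <;> omega
  · exact av_neg hw h a c h1 (by omega) (by omega) ha hc

lemma av_claim {m : ℕ} {w : Equiv.Perm ℤ} (hw : IsSignedPerm (m+2) w)
    (h : ∀ p ∈ pats, ¬ containsPat (m+2) w p) :
    w (m+2) = m+2 ∨ w (m+1) = m+2 ∨ w (m+2) = m+1 := by
  by_contra hcon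
  push Not at hcon
  obtain ⟨c1, c2, c3⟩ := hcon
  obtain ⟨a, ha1, ha2, ha⟩ := sp_surj hw (y := m+2) (by omega) (by push_cast; omega)
  obtain ⟨b, hb1, hb2, hb⟩ := sp_surj hw (y := m+1) (by omega) (by push_cast; omega)
  have hN : ((m + 2 : ℕ) : ℤ) = m + 2 := by push_cast; rfl
  rw [hN] at ha2 hb2
  have haa : |w a| = m + 2 := by
    rcases ha with h | h <;> rw [h]
    · exact abs_of_pos (by omega)
    · rw [abs_neg]; exact abs_of_pos (by omega)
  have hbb : |w b| = m + 1 := by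
    rcases hb with h | h <;> rw [h]
    · exact abs_of_pos (by omega)
    · rw [abs_neg]; exact abs_of_pos (by omega)
  have hba : b ≠ a := by rintro rfl; omega
  have hinj : ∀ x y : ℤ, 1 ≤ x → 1 ≤ y → |w x| = |w y| → x = y :=
    fun x y hx hy hxy => sp_abs_inj hw hx hy hxy
  have hr := sp_range hw (x := m+2) (by omega) (by omega)
  rw [hN] at hr
  have hr1 := sp_range hw (x := m+1) (by omega) (by omega)
  rw [hN] at hr1
  rcases ha with ha | ha
  · have ham : a ≤ m := by
      rcases lt_trichotomy a (m+1) with h | h | h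
      · omega
      · rw [h] at ha; omega
      · have : a = m + 2 := by omega
        rw [this] at ha; omega
    have hlt : |w (m+1)| < |w (m+2)| := by
      by_contra hge
      have hne : |w (m+1)| ≠ |w (m+2)| := fun e => by
        have := hinj _ _ (by omega) (by omega) e; omega
      have hne' : |w (m+1)| ≠ |w a| := fun e => by
        have := hinj _ _ (by omega) (by omega) e; omega
      exact av_3 hw h a (m+1) (m+2) ha1 (by omega) (by omega) (by omega) (by omega)
        (by omega) (by omega)
    have hneA : |w (m+2)| ≠ |w a| := fun e => by
      have := hinj _ _ (by omega) (by omega) e; omega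
    have hpos : 0 < w (m+2) := by
      rcases sp_sign hw (x := m+2) (by omega) (by omega) with h' | h'
      · exact h'
      · exfalso
        rcases sp_sign hw (x := m+1) (by omega) (by omega) with h'' | h''
        · exact av_pn h (m+1) (m+2) (by omega) (by omega) (by omega) h'' h' hlt
        · exact av_neg hw h (m+1) (m+2) (by omega) (by omega) (by omega) h'' h'
    have hbN : b ≠ m + 2 := by
      rintro rfl
      rcases hb with hb | hb <;> omega
    have hneB : |w (m+2)| ≠ |w b| := fun e => hbN (hinj _ _ (by omega) (by omega) e).symm
    rcases lt_or_gt_of_ne hba with hlt' | hgt'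
    · exact av_4 hw h b a (m+1) (m+2) hb1 hlt' (by omega) (by omega) (by omega) (by omega) hpos hlt
        (by omega) (by omega)
    · exact av_3 hw h a b (m+2) ha1 hgt' (by omega) (by omega) (by omega) (by omega) (by omega)
  · have ha1' : a = 1 := by
      by_contra hne
      have hr2 := sp_range hw (x := 1) (by omega) (by omega)
      rw [hN] at hr2
      have : |w 1| ≠ |w a| := fun e => hne (hinj _ _ (by omega) (by omega) e).symm
      rcases sp_sign hw (x := 1) (by omega) (by omega) with h' | h'
      · exact av_pn h 1 a (by omega) (by omega) (by omega) h' (by omega) (by omega)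
      · exact av_neg hw h 1 a (by omega) (by omega) (by omega) h' (by omega)
    subst ha1'
    have hpos : ∀ x : ℤ, 1 < x → x ≤ m + 2 → 0 < w x := by
      intro x hx hx'
      rcases sp_sign hw (x := x) (by omega) (by omega) with h' | h'
      · exact h'
      · exact (av_neg hw h 1 x (by omega) (by omega) (by omega) (by omega) h').elim
    have hbp := hpos b (by omega) (by omega)
    have hNp := hpos (m+2) (by omega) (by omega)
    have hbN : b ≠ m + 2 := by
      rintro rfl
      rcases hb with hb | hb <;> omega
    have hneB : |w (m+2)| ≠ |w b| := fun e => hbN (hinj _ _ (by omega) (by omega) e).symm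
    have hneA : |w (m+2)| ≠ |w 1| := fun e => by
      have := hinj _ _ (by omega) (by omega) e; omega
    exact av_3' h 1 b (m+2) (by omega) (by omega) (by omega) (by omega) (by omega) hbp hNp
      (by omega) (by omega)

lemma pat_transfer {m : ℕ} {w u : Equiv.Perm ℤ} {p : List ℤ} (f : Fin p.length → ℤ)
    (hs : ∀ j, 0 < w (f j) ↔ 0 < p.get j)
    (ho : ∀ j j', |w (f j)| < |w (f j')| ↔ |p.get j| < |p.get j'|) (φ : ℤ → ℤ)
    (h1 : ∀ j k, j < k → φ (f j) < φ (f k)) (h2 : ∀ j, 1 ≤ φ (f j) ∧ φ (f j) ≤ (m : ℤ))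
    (h3 : ∀ j, 0 < u (φ (f j)) ↔ 0 < w (f j))
    (h4 : ∀ j k, |u (φ (f j))| < |u (φ (f k))| ↔ |w (f j)| < |w (f k)|) :
    containsPat m u p :=
  ⟨fun j => φ (f j), fun j k hjk => h1 j k hjk, h2, fun j => (h3 j).trans (hs j),
    fun j k => (h4 j k).trans (ho j k)⟩

/-- The properties of the ten patterns that are needed. -/
def GoodPat (p : List ℤ) : Prop :=
  ∃ (last prev : Fin p.length), prev.1 + 1 = last.1 ∧ last.1 + 1 = p.length ∧
    (0 < p.get last → ∃ j j', |p.get last| < |p.get j| ∧ |p.get j| < |p.get j'|) ∧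
    (0 < p.get prev → ∃ j, |p.get prev| < |p.get j|)

lemma good_pats : ∀ p ∈ pats, GoodPat p := by
  intro p hp
  simp only [pats, List.mem_cons, List.not_mem_nil, or_false] at hp
  rcases hp with rfl | rfl | rfl | rfl | rfl | rfl | rfl | rfl | rfl | rfl
  · exact ⟨⟨1, by simp⟩, ⟨0, by simp⟩, by simp, by simp, by simp, by simp⟩
  · exact ⟨⟨1, by simp⟩, ⟨0, by simp⟩, by simp, by simp, by simp, by simp⟩
  · exact ⟨⟨2, by simp⟩, ⟨1, by simp⟩, by simp, by simp,
      fun _ => ⟨⟨1, by simp⟩, ⟨0, by simp⟩, by simp⟩, fun _ => ⟨⟨0, by simp⟩, by simp⟩⟩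
  · exact ⟨⟨3, by simp⟩, ⟨2, by simp⟩, by simp, by simp,
      fun _ => ⟨⟨0, by simp⟩, ⟨1, by simp⟩, by simp⟩, fun _ => ⟨⟨0, by simp⟩, by simp⟩⟩
  · exact ⟨⟨2, by simp⟩, ⟨1, by simp⟩, by simp, by simp, by simp, fun _ => ⟨⟨0, by simp⟩, by simp⟩⟩
  · exact ⟨⟨3, by simp⟩, ⟨2, by simp⟩, by simp, by simp,
      fun _ => ⟨⟨0, by simp⟩, ⟨1, by simp⟩, by simp⟩, by simp⟩
  · exact ⟨⟨2, by simp⟩, ⟨1, by simp⟩, by simp, by simp,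
      fun _ => ⟨⟨1, by simp⟩, ⟨0, by simp⟩, by simp⟩, fun _ => ⟨⟨0, by simp⟩, by simp⟩⟩
  · exact ⟨⟨3, by simp⟩, ⟨2, by simp⟩, by simp, by simp,
      fun _ => ⟨⟨0, by simp⟩, ⟨1, by simp⟩, by simp⟩, fun _ => ⟨⟨0, by simp⟩, by simp⟩⟩
  · exact ⟨⟨1, by simp⟩, ⟨0, by simp⟩, by simp, by simp, by simp, fun _ => ⟨⟨1, by simp⟩, by simp⟩⟩
  · exact ⟨⟨2, by simp⟩, ⟨1, by simp⟩, by simp, by simp,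
      fun _ => ⟨⟨1, by simp⟩, ⟨0, by simp⟩, by simp⟩, by simp⟩

lemma signed_prodB {m : ℕ} {b : List ℕ} (hb : ∀ i ∈ b, i < m) : IsSignedPerm m (prodB b) := by
  refine ⟨prodB_odd b, ?_⟩
  induction b with
  | nil => intro x _; rfl
  | cons i b ih =>
    intro x hx
    rw [prodB_cons, Equiv.Perm.mul_apply, ih (fun j hj => hb j (by simp [hj])) x hx]
    have hi := hb i (by simp)
    rcases i with _ | i
    · rw [sB_zero_apply]
      have : |x| = x ∨ |x| = -x := abs_choice x
      split_ifs <;> omega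
    · rw [sB_succ_apply]
      have : |x| = x ∨ |x| = -x := abs_choice x
      split_ifs <;> omega

/-- behaviour of the top generator on `±[1, m+1]` -/
lemma sB_abs (m : ℕ) (y : ℤ) (h : 1 ≤ |y|) (h' : |y| ≤ m + 1) :
    (0 < sB (m+1) y ↔ 0 < y) ∧ |sB (m+1) y| = if |y| = m + 1 then (m : ℤ) + 2 else |y| := by
  rw [sB_succ_apply]
  simp only [abs] at *
  constructor
  · split_ifs <;> omega
  · split_ifs <;> omega

lemma avoid_step {m : ℕ} {u w : Equiv.Perm ℤ} (hu : IsSignedPerm (m+1) u)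
    (hw : IsSignedPerm (m+2) w) {p : List ℤ} (hp : GoodPat p)
    (hav : ¬ containsPat (m+1) u p) (hcase : w = u ∨ w = u * sB (m+1) ∨ w = sB (m+1) * u) :
    ¬ containsPat (m+2) w p := by
  rintro ⟨f, hf, hr, hs, ho⟩
  apply hav
  obtain ⟨last, prev, hlp, hl, hg1, hg2⟩ := hp
  have hN : ((m + 2 : ℕ) : ℤ) = m + 2 := by push_cast; rfl
  have hN1 : ((m + 1 : ℕ) : ℤ) = m + 1 := by push_cast; rfl
  rw [hN] at hr
  have hup : u (m+2) = m+2 := hu.2 _ (by rw [hN1, abs_of_pos] <;> omega)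
  have hrange : ∀ j, 1 ≤ |w (f j)| ∧ |w (f j)| ≤ m + 2 := by
    intro j
    have := sp_range hw (hr j).1 (by rw [hN]; exact (hr j).2)
    rwa [hN] at this
  have hle : ∀ j, f j ≤ f last := fun j => hf.monotone (by rw [Fin.le_def]; omega)
  have hlast := hr last
  -- if the last position is not used, we can use the identity
  rcases hcase with rfl | rfl | rfl
  · have hne : f last ≠ m + 2 := by
      intro he
      have hpos := (hs last).1 (by rw [he, hup]; omega)
      obtain ⟨j, _, hj, _⟩ := hg1 hpos
      have := (ho _ _).2 hj
      rw [he, hup, abs_of_pos (by omega)] at this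
      have := hrange j
      omega
    refine pat_transfer f hs ho id (fun j k h => hf h) (fun j => ?_) (fun j => Iff.rfl)
      (fun j k => Iff.rfl)
    have := hle j
    have := hr j
    simp only [id]
    omega
  · have hsm : sB (m+1) ((m:ℤ)+1) = m+2 := by rw [sB_succ_apply]; simp
    have hsm2 : sB (m+1) ((m:ℤ)+2) = m+1 := by rw [sB_succ_apply]; simp
    have hsl : ∀ x : ℤ, 1 ≤ x → x ≤ m → sB (m+1) x = x := by
      intro x h1 h2
      rw [sB_succ_apply]; split_ifs <;> omega
    have hwtop : (u * sB (m+1)) ((m:ℤ)+1) = m + 2 := by rw [Equiv.Perm.mul_apply, hsm, hup]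
    have hne : ∀ j, f j ≠ m + 1 := by
      intro j he
      have hpos := (hs j).1 (by rw [he, hwtop]; omega)
      have : ∃ j', |p.get j| < |p.get j'| := by
        rcases lt_trichotomy j prev with h | h | h
        · have h1 := hf h
          have h2 := hf (show prev < last by rw [Fin.lt_def]; omega)
          omega
        · subst h; exact hg2 hpos
        · have : j = last := by rw [Fin.lt_def] at h; apply Fin.ext; omega
          subst this
          obtain ⟨j', _, h, _⟩ := hg1 hpos
          exact ⟨j', h⟩
      obtain ⟨j', hj'⟩ := this
      have := (ho _ _).2 hj'
      rw [he, hwtop, abs_of_pos (by omega)] at this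
      have := hrange j'
      omega
    have hval : ∀ j, u (if f j = m + 2 then (m:ℤ)+1 else f j) = (u * sB (m+1)) (f j) := by
      intro j
      rw [Equiv.Perm.mul_apply]
      have := hr j
      have := hne j
      split_ifs with h
      · rw [h, hsm2]
      · rw [hsl _ (by omega) (by omega)]
    refine pat_transfer f hs ho (fun x => if x = m + 2 then m + 1 else x) (fun j k h => ?_)
      (fun j => ?_) (fun j => ?_) (fun j k => ?_)
    · have := hf h
      have := hr j
      have := hr k
      have := hne j
      have := hne k
      split_ifs <;> omega
    · have := hr j
      have := hne j
      split_ifs <;> omega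
    · simp only [hval]
    · simp only [hval]
  · have hsm2 : sB (m+1) ((m:ℤ)+2) = m+1 := by rw [sB_succ_apply]; simp
    have hwtop : (sB (m+1) * u) ((m:ℤ)+2) = m + 1 := by rw [Equiv.Perm.mul_apply, hup, hsm2]
    have hne : f last ≠ m + 2 := by
      intro he
      have hpos := (hs last).1 (by rw [he, hwtop]; omega)
      obtain ⟨j, j', hj, hj'⟩ := hg1 hpos
      have h1 := (ho _ _).2 hj
      have h2 := (ho _ _).2 hj'
      rw [he, hwtop, abs_of_pos (by omega)] at h1
      have := hrange j'
      omega
    have hb : ∀ j, 1 ≤ f j ∧ f j ≤ m + 1 := by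
      intro j
      have := hle j
      have := hr j
      omega
    have hab : ∀ j, 1 ≤ |u (f j)| ∧ |u (f j)| ≤ m + 1 := by
      intro j
      have := sp_range hu (hb j).1 (by rw [hN1]; exact (hb j).2)
      rwa [hN1] at this
    refine pat_transfer f hs ho id (fun j k h => hf h) (fun j => ?_) (fun j => ?_) (fun j k => ?_)
    · rw [hN1]; exact hb j
    · exact (sB_abs m _ (hab j).1 (hab j).2).1.symm
    · simp only [id, Equiv.Perm.mul_apply]
      rw [(sB_abs m _ (hab j).1 (hab j).2).2, (sB_abs m _ (hab k).1 (hab k).2).2]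
      have := hab j
      have := hab k
      split_ifs <;> omega

lemma avoid_of_nodup (n : ℕ) (b : List ℕ) (hb : ∀ i ∈ b, i < n) (hn : b.Nodup) (p : List ℤ)
    (hp : GoodPat p) : ¬ containsPat n (prodB b) p := by
  induction n generalizing b with
  | zero =>
    rintro ⟨f, -, hr, -⟩
    obtain ⟨last, -⟩ := hp
    have := hr last
    push_cast at this
    omega
  | succ n ih =>
    rcases n with _ | m
    · rintro ⟨f, hf, hr, -⟩
      obtain ⟨last, prev, h, -⟩ := hp
      have h1 := hf (show prev < last by rw [Fin.lt_def]; omega)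
      have := hr last
      have := hr prev
      push_cast at this
      omega
    · by_cases hm : m + 1 ∈ b
      · obtain ⟨a, c, rfl⟩ := List.append_of_mem hm
        have ha : ∀ i ∈ a ++ c, i < m + 1 := by
          intro i hi
          have h1 := hb i (by grind)
          have h2 : i ≠ m + 1 := by grind
          omega
        have hac : (a ++ c).Nodup := by grind
        refine avoid_step (signed_prodB ha) (signed_prodB hb) hp (ih _ ha hac) (Or.inr ?_)
        by_cases hma : m ∈ a
        · left
          have hmc : ∀ j ∈ c, m + 1 + 1 < j ∨ j + 1 < m + 1 := by
            intro j hj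
            have := ha j (by grind)
            have : j ≠ m := by grind
            omega
          rw [prodB_append, prodB_cons, prodB_comm _ _ hmc, prodB_append, mul_assoc]
        · right
          have hmc : ∀ j ∈ a, m + 1 + 1 < j ∨ j + 1 < m + 1 := by
            intro j hj
            have := ha j (by grind)
            have : j ≠ m := by grind
            omega
          rw [prodB_append, prodB_cons, ← mul_assoc, ← prodB_comm _ _ hmc, prodB_append, mul_assoc]
      · have hb' : ∀ i ∈ b, i < m + 1 := by
          intro i hi
          have h1 := hb i hi
          have h2 : i ≠ m + 1 := by rintro rfl; exact hm hi
          omega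
        exact avoid_step (signed_prodB hb') (signed_prodB hb) hp (ih _ hb' hn) (Or.inl rfl)

lemma sp_mul {n : ℕ} {u v : Equiv.Perm ℤ} (hu : IsSignedPerm n u) (hv : IsSignedPerm n v) :
    IsSignedPerm n (u * v) := by
  refine ⟨fun x => ?_, fun x hx => ?_⟩
  · simp [hv.1, hu.1]
  · rw [Equiv.Perm.mul_apply, hv.2 x hx, hu.2 x hx]

lemma sp_down {m : ℕ} {u : Equiv.Perm ℤ} (hu : IsSignedPerm (m+2) u) (h : u (m+2) = m+2) :
    IsSignedPerm (m+1) u := by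
  refine ⟨hu.1, fun x hx => ?_⟩
  by_cases h2 : ((m+2 : ℕ) : ℤ) < |x|
  · exact hu.2 x h2
  · push_cast at hx h2
    have : |x| = m + 2 := by omega
    rcases abs_choice x with h' | h'
    · rw [show x = m + 2 by omega, h]
    · rw [show x = -((m:ℤ) + 2) by omega, hu.1, h]

lemma nodup_of_avoid (n : ℕ) (w : Equiv.Perm ℤ) (hw : IsSignedPerm n w)
    (h : ∀ p ∈ pats, ¬ containsPat n w p) :
    ∃ b : List ℕ, (∀ i ∈ b, i < n) ∧ b.Nodup ∧ prodB b = w := by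
  induction n generalizing w with
  | zero =>
    refine ⟨[], by simp, by simp, ?_⟩
    ext x
    rw [prodB_nil, Equiv.Perm.one_apply]
    by_cases hx : x = 0
    · subst hx; rw [sp_zero hw]
    · rw [hw.2 x (by simpa using hx)]
  | succ n ih =>
    rcases n with _ | m
    · have h1 := sp_range hw (x := 1) (by omega) (by simp)
      have hbig : ∀ x : ℤ, x ≠ 0 → x ≠ 1 → x ≠ -1 → w x = x := by
        intro x h0 h1 h2
        apply hw.2
        have := abs_choice x
        have := abs_nonneg x
        push_cast
        omega
      have : w 1 = 1 ∨ w 1 = -1 := by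
        have := abs_choice (w 1)
        push_cast at h1
        omega
      have hm1 := hw.1 1
      rcases this with h1 | h1
      · refine ⟨[], by simp, by simp, ?_⟩
        ext x
        rw [prodB_nil, Equiv.Perm.one_apply]
        by_cases h0 : x = 0
        · rw [h0, sp_zero hw]
        by_cases h2 : x = 1
        · rw [h2, h1]
        by_cases h3 : x = -1
        · rw [h3, hm1, h1]
        rw [hbig x h0 h2 h3]
      · refine ⟨[0], by simp, by simp, ?_⟩
        ext x
        rw [prodB_cons, prodB_nil, mul_one, sB_zero_apply]
        by_cases h0 : x = 0
        · rw [h0, sp_zero hw]; simp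
        by_cases h2 : x = 1
        · rw [h2, h1]; simp
        by_cases h3 : x = -1
        · rw [h3, hm1, h1]; simp
        rw [hbig x h0 h2 h3, if_neg h2, if_neg h3]
    · have hsS : IsSignedPerm (m+2) (sB (m+1)) := by
        have := signed_prodB (m := m+2) (b := [m+1]) (by simp)
        simpa [prodB] using this
      have hN : ((m + 2 : ℕ) : ℤ) = m + 2 := by push_cast; rfl
      have hN1 : ((m + 1 : ℕ) : ℤ) = m + 1 := by push_cast; rfl
      have hsm : sB (m+1) ((m:ℤ)+1) = m+2 := by rw [sB_succ_apply]; simp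
      have hsm2 : sB (m+1) ((m:ℤ)+2) = m+1 := by rw [sB_succ_apply]; simp
      have hsl : ∀ x : ℤ, 1 ≤ x → x ≤ m → sB (m+1) x = x := by
        intro x h1 h2
        rw [sB_succ_apply]; split_ifs <;> omega
      rcases av_claim hw h with hc | hc | hc
      · obtain ⟨b, h1, h2, h3⟩ := ih w (sp_down hw hc) (by
          rintro p hp ⟨f, hf, hr, hs, ho⟩
          refine h p hp ⟨f, hf, fun j => ?_, hs, ho⟩
          have := hr j
          omega)
        exact ⟨b, fun i hi => by have := h1 i hi; omega, h2, h3⟩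
      · have hval : ∀ x : ℤ, 1 ≤ x → x ≤ m + 1 →
            w (if x = m + 1 then (m:ℤ)+2 else x) = (w * sB (m+1)) x := by
          intro x hx hx'
          rw [Equiv.Perm.mul_apply]
          split_ifs with h'
          · rw [h', hsm]
          · rw [hsl _ hx (by omega)]
        obtain ⟨b, h1, h2, h3⟩ := ih (w * sB (m+1))
          (sp_down (sp_mul hw hsS) (by rw [Equiv.Perm.mul_apply, hsm2, hc])) (by
          rintro p hp ⟨f, hf, hr, hs, ho⟩
          rw [hN1] at hr
          have hv : ∀ j, w (if f j = m + 1 then (m:ℤ)+2 else f j) = (w * sB (m+1)) (f j) :=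
            fun j => hval _ (hr j).1 (hr j).2
          refine h p hp (pat_transfer f hs ho (fun x => if x = m + 1 then m + 2 else x)
            (fun j k hjk => ?_) (fun j => ?_) (fun j => ?_) (fun j k => ?_))
          · have := hf hjk
            have := hr j
            have := hr k
            split_ifs <;> omega
          · have := hr j
            split_ifs <;> omega
          · simp only [hv]
          · simp only [hv])
        refine ⟨b ++ [m+1], ?_, ?_, ?_⟩
        · intro i hi
          rcases List.mem_append.1 hi with hi | hi
          · have := h1 i hi; omega
          · simp at hi; omega
        · rw [List.nodup_append]
          refine ⟨h2, by simp, ?_⟩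
          intro x hx y hy
          simp at hy
          have := h1 x hx
          omega
        · rw [prodB_append, h3, prodB_cons, prodB_nil, mul_one, mul_assoc, sB_mul_self, mul_one]
      · have habs : ∀ x : ℤ, 1 ≤ x → x ≤ m + 1 → (0 < w x ↔ 0 < sB (m+1) (w x)) ∧
            |w x| = if |sB (m+1) (w x)| = m + 1 then (m:ℤ)+2 else |sB (m+1) (w x)| := by
          intro x hx hx'
          have hr := sp_range hw hx (by omega)
          rw [hN] at hr
          have hne : |w x| ≠ m + 1 := by
            intro he
            have : |w x| = |w (m+2)| := by rw [he, hc, abs_of_pos (by omega)]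
            have := sp_abs_inj hw hx (by omega) this
            omega
          rw [sB_succ_apply]
          simp only [abs] at *
          constructor
          · split_ifs <;> omega
          · split_ifs <;> omega
        obtain ⟨b, h1, h2, h3⟩ := ih (sB (m+1) * w)
          (sp_down (sp_mul hsS hw) (by rw [Equiv.Perm.mul_apply, hc, hsm])) (by
          rintro p hp ⟨f, hf, hr, hs, ho⟩
          rw [hN1] at hr
          have hsp : IsSignedPerm (m+1) (sB (m+1) * w) :=
            sp_down (sp_mul hsS hw) (by rw [Equiv.Perm.mul_apply, hc, hsm])
          refine h p hp (pat_transfer f hs ho id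
            (fun j k hjk => hf hjk) (fun j => ?_) (fun j => ?_) (fun j k => ?_))
          · have := hr j
            simp only [id]
            omega
          · exact (habs _ (hr j).1 (hr j).2).1
          · simp only [id]
            rw [(habs _ (hr j).1 (hr j).2).2, (habs _ (hr k).1 (hr k).2).2]
            have r1 := sp_range hsp (hr j).1 (by rw [hN1]; exact (hr j).2)
            have r2 := sp_range hsp (hr k).1 (by rw [hN1]; exact (hr k).2)
            rw [hN1, Equiv.Perm.mul_apply] at r1 r2
            simp only [Equiv.Perm.mul_apply]
            split_ifs <;> omega)
        refine ⟨(m+1) :: b, ?_, ?_, ?_⟩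
        · intro i hi
          rcases List.mem_cons.1 hi with hi | hi
          · omega
          · have := h1 i hi; omega
        · rw [List.nodup_cons]
          exact ⟨fun hx => by have := h1 _ hx; omega, h2⟩
        · rw [prodB_cons, h3, ← mul_assoc, sB_mul_self, one_mul]

theorem stmt16 (n : ℕ) (w : Equiv.Perm ℤ) (hw : IsSignedPerm n w) :
    BooleanB n w ↔
      (avoidsPat n w [-1,-2] ∧ avoidsPat n w [-2,-1] ∧
       avoidsPat n w [3,2,1] ∧ avoidsPat n w [3,4,1,2] ∧
       avoidsPat n w [3,2,-1] ∧ avoidsPat n w [3,4,-1,2] ∧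
       avoidsPat n w [-3,2,1] ∧ avoidsPat n w [-3,4,1,2] ∧
       avoidsPat n w [1,-2] ∧ avoidsPat n w [3,-2,1]) := by
  have hpats : (∀ p ∈ pats, ¬ containsPat n w p) ↔
      (avoidsPat n w [-1,-2] ∧ avoidsPat n w [-2,-1] ∧
       avoidsPat n w [3,2,1] ∧ avoidsPat n w [3,4,1,2] ∧
       avoidsPat n w [3,2,-1] ∧ avoidsPat n w [3,4,-1,2] ∧
       avoidsPat n w [-3,2,1] ∧ avoidsPat n w [-3,4,1,2] ∧
       avoidsPat n w [1,-2] ∧ avoidsPat n w [3,-2,1]) := by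
    simp only [pats, List.forall_mem_cons, avoidsPat]
    simp
  rw [← hpats]
  constructor
  · intro h p hp
    obtain ⟨b, hb, hn, rfl⟩ := nodup_of_boolean h
    rcases n with _ | n
    · rintro ⟨f, -, hr, -⟩
      obtain ⟨last, -⟩ := good_pats p hp
      have := hr last
      push_cast at this
      omega
    · exact avoid_of_nodup (n+1) b (fun i hi => by have := hb i hi; omega) hn p (good_pats p hp)
  · intro h
    obtain ⟨b, h1, h2, rfl⟩ := nodup_of_avoid n w hw h
    exact boolean_of_nodup (fun i hi => by have := h1 i hi; omega) h2

end Paper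
end
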